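/- Let d ≥ 1, and let m, p, q ≥ 1 be integers, μ ≥ 0, b, c ∈ ℝ, s > d/2, s₁ ∈ (d/2, s) with s − s₁ ≤ m, T > 0 and M > 0. Then there exist ε₀ > 0 and a constant C > 0, depending only on d, m, p, q, μ, b, c, s, s₁, T and M, such that for every ε ∈ (0, ε₀) the following holds. Suppose v : [0, T] → h^s is continuously differentiable, satisfies |v(τ)|_s ≤ M for all τ ∈ [0, T], and solves coordinatewise the system d/dτ v_k(τ) = ε⁻¹ i λ_k v_k(τ) − μ λ_k^m v_k(τ) + b P_k(v(τ), p) + i c P_k(v(τ), q) for all k ∈ ℤ^d. Suppose a′ : [0, T] → h^s is continuously differentiable with a′(0) = v(0) and solves coordinatewise the effective equation d/dτ a′_k(τ) = − μ λ_k^m a′_k(τ) + b R_k(a′(τ), p) + i c R_k(a′(τ), q) for all k ∈ ℤ^d. Then |a′(τ)|_s ≤ M + 1 for all τ ∈ [0, T], and for all τ ∈ [0, T] one has Σ_{k∈ℤ^d} (|k|^{2s₁} + 1) | |v_k(τ)|² − |a′_k(τ)|² | ≤ C (ε^{(s−s₁)/(2m)} + ε^{1/2}). -/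

import Mathlib

open scoped BigOperators

/-- `lam d k = |k|²`, the squared Euclidean norm of `k ∈ ℤ^d`. -/
def lam (d : ℕ) (k : Fin d → ℤ) : ℤ := ∑ i, (k i) ^ 2

/-- The weight `|k|^{2s} + 1 = (|k|²)^s + 1` in the definition of the `h^s` norm. -/
noncomputable def wt (d : ℕ) (s : ℝ) (k : Fin d → ℤ) : ℝ := ((lam d k : ℝ)) ^ s + 1

/-- `v ∈ h^s`, i.e. the series defining `|v|_s²` converges. -/
def memH (d : ℕ) (s : ℝ) (v : (Fin d → ℤ) → ℂ) : Prop :=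
  Summable fun k => wt d s k * ‖v k‖ ^ 2

/-- The norm `|v|_s` of `h^s`. -/
noncomputable def hnorm (d : ℕ) (s : ℝ) (v : (Fin d → ℤ) → ℂ) : ℝ :=
  Real.sqrt (∑' k, wt d s k * ‖v k‖ ^ 2)

/-- The summand of `P_k(v,n)`: the monomial `v_{k₁} conj(v_{k₂}) ⋯ v_{k_{2n+1}}` if the
tuple `κ` lies in `S(k,n)` (i.e. the alternating sum of `κ` equals `k`), and `0` otherwise. -/
noncomputable def Pterm (d n : ℕ) (v : (Fin d → ℤ) → ℂ) (k : Fin d → ℤ)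
    (κ : Fin (2 * n + 1) → (Fin d → ℤ)) : ℂ :=
  if (∑ j : Fin (2 * n + 1), ((-1 : ℤ) ^ (j : ℕ)) • κ j) = k then
    ∏ j : Fin (2 * n + 1), (if Even (j : ℕ) then v (κ j) else (starRingEnd ℂ) (v (κ j)))
  else 0

/-- `P_k(v,n) = Σ_{(k₁,…,k_{2n+1}) ∈ S(k,n)} v_{k₁} conj(v_{k₂}) ⋯ v_{k_{2n+1}}`. -/
noncomputable def Pk (d n : ℕ) (v : (Fin d → ℤ) → ℂ) (k : Fin d → ℤ) : ℂ :=
  ∑' κ : Fin (2 * n + 1) → (Fin d → ℤ), Pterm d n v k κ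

/-- The summand of `R_k(v,n)`: as `Pterm`, but restricted to resonant tuples. -/
noncomputable def Rterm (d n : ℕ) (v : (Fin d → ℤ) → ℂ) (k : Fin d → ℤ)
    (κ : Fin (2 * n + 1) → (Fin d → ℤ)) : ℂ :=
  if (∑ j : Fin (2 * n + 1), ((-1 : ℤ) ^ (j : ℕ)) • κ j) = k ∧
      (∑ j : Fin (2 * n + 1), ((-1 : ℤ) ^ (j : ℕ)) * lam d (κ j)) = lam d k then
    ∏ j : Fin (2 * n + 1), (if Even (j : ℕ) then v (κ j) else (starRingEnd ℂ) (v (κ j)))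
  else 0

/-- `R_k(v,n)`, the resonant part of `P_k(v,n)`. -/
noncomputable def Rk (d n : ℕ) (v : (Fin d → ℤ) → ℂ) (k : Fin d → ℤ) : ℂ :=
  ∑' κ : Fin (2 * n + 1) → (Fin d → ℤ), Rterm d n v k κ

/-- Continuity of a curve `v : [0,T] → h^s` with respect to the norm `|·|_s`. -/
def hContOn (d : ℕ) (s : ℝ) (T : ℝ) (v : ℝ → (Fin d → ℤ) → ℂ) : Prop :=
  ∀ τ₀ ∈ Set.Icc (0 : ℝ) T,
    Filter.Tendsto (fun τ => hnorm d s (fun k => v τ k - v τ₀ k))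
      (nhdsWithin τ₀ (Set.Icc 0 T)) (nhds 0)

/-! ### Weights -/

lemma lam_nonneg (d : ℕ) (k : Fin d → ℤ) : 0 ≤ lam d k :=
  Finset.sum_nonneg fun _ _ => sq_nonneg _

lemma lam_cast_nonneg (d : ℕ) (k : Fin d → ℤ) : (0 : ℝ) ≤ lam d k := by
  exact_mod_cast lam_nonneg d k

lemma one_le_wt (d : ℕ) (σ : ℝ) (k : Fin d → ℤ) : 1 ≤ wt d σ k := by
  have := Real.rpow_nonneg (lam_cast_nonneg d k) σ
  unfold wt; linarith

lemma wt_pos (d : ℕ) (σ : ℝ) (k : Fin d → ℤ) : 0 < wt d σ k :=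
  lt_of_lt_of_le one_pos (one_le_wt d σ k)

/-- The finite partial sums of `1 / wt` are bounded when `σ > d / 2`. -/
lemma exists_sum_inv_wt_le (d : ℕ) (hd : 1 ≤ d) (σ : ℝ) (hσ : (d : ℝ) / 2 < σ) :
    ∃ S : ℝ, 1 ≤ S ∧ ∀ K : Finset (Fin d → ℤ), ∑ k ∈ K, (wt d σ k)⁻¹ ≤ S := by
  have hd0 : (0 : ℝ) < d := by exact_mod_cast hd
  set β : ℝ := 2 * σ / d with hβ
  have hβ1 : 1 < β := by rw [hβ, lt_div_iff₀ hd0]; linarith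
  set g : ℤ → ℝ := fun x => (max 1 |(x : ℝ)|) ^ (-β) with hg
  have hg0 : ∀ x, 0 ≤ g x := fun x => Real.rpow_nonneg (le_max_of_le_left zero_le_one) _
  have hgs : Summable g := by
    have h1 : Summable fun x : ℤ => |(x : ℝ)| ^ (-β) := Real.summable_abs_int_rpow hβ1
    refine (summable_congr_cofinite ?_).mp h1
    rw [Filter.eventuallyEq_iff_exists_mem]
    refine ⟨{0}ᶜ, (Set.finite_singleton 0).compl_mem_cofinite, fun x hx => ?_⟩
    have : (1 : ℝ) ≤ |(x : ℝ)| := by exact_mod_cast Int.one_le_abs hx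
    simp [hg, max_eq_right this]
  set S₀ := ∑' x, g x
  have hS₀ : 1 ≤ S₀ := by
    have := hgs.le_tsum 0 (fun j _ => hg0 j)
    simpa [hg] using this
  have key : ∀ k : Fin d → ℤ, (wt d σ k)⁻¹ ≤ ∏ i, g (k i) := by
    intro k
    set L : ℝ := max 1 (lam d k : ℝ) with hL
    have hL1 : 1 ≤ L := le_max_left _ _
    have h1 : ∏ i : Fin d, (max 1 |(k i : ℝ)|) ^ β ≤ ∏ _i : Fin d, L ^ (σ / d) := by
      refine Finset.prod_le_prod (fun i _ => by positivity) fun i _ => ?_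
      have h2 : (max 1 |(k i : ℝ)|) ^ (2 : ℝ) ≤ L := by
        rw [Real.rpow_two]
        rcases max_choice (1 : ℝ) |(k i : ℝ)| with h | h
        · rw [h]; simpa using hL1
        · rw [h, sq_abs]
          refine le_trans ?_ (le_max_right _ _)
          unfold lam; push_cast
          exact Finset.single_le_sum (f := fun i => (k i : ℝ) ^ 2)
            (fun i _ => sq_nonneg _) (Finset.mem_univ i)
      have h3 : β = 2 * (σ / d) := by rw [hβ]; ring
      rw [h3, Real.rpow_mul (by positivity)]
      exact Real.rpow_le_rpow (by positivity) h2 (by apply div_nonneg <;> linarith)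
    have h4 : ∏ _i : Fin d, L ^ (σ / d) = L ^ σ := by
      rw [Finset.prod_const, ← Real.rpow_natCast, ← Real.rpow_mul (by positivity)]
      congr 1
      simp; field_simp
    have h5 : L ^ σ ≤ wt d σ k := by
      unfold wt
      have := Real.rpow_nonneg (lam_cast_nonneg d k) σ
      rcases max_choice (1 : ℝ) (lam d k : ℝ) with h | h
      · rw [hL, h]; simp; linarith
      · rw [hL, h]; linarith
    have h6 : ∏ i, g (k i) = (∏ i : Fin d, (max 1 |(k i : ℝ)|) ^ β)⁻¹ := by
      rw [← Finset.prod_inv_distrib]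
      exact Finset.prod_congr rfl fun i _ => Real.rpow_neg (by positivity) _
    rw [h6]
    refine inv_anti₀ (Finset.prod_pos fun i _ => by positivity) ?_
    linarith
  refine ⟨S₀ ^ d, one_le_pow₀ hS₀, fun K => ?_⟩
  calc ∑ k ∈ K, (wt d σ k)⁻¹ ≤ ∑ k ∈ K, ∏ i, g (k i) := Finset.sum_le_sum fun k _ => key k
    _ ≤ ∑ k ∈ Fintype.piFinset fun i => K.image fun k => k i, ∏ i, g (k i) := by
        refine Finset.sum_le_sum_of_subset_of_nonneg (fun k hk => ?_)
          fun k _ _ => Finset.prod_nonneg fun i _ => hg0 _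
        rw [Fintype.mem_piFinset]
        exact fun i => Finset.mem_image_of_mem _ hk
    _ = ∏ i, ∑ x ∈ K.image fun k => k i, g x := (Finset.prod_univ_sum _ _).symm
    _ ≤ ∏ _i : Fin d, S₀ := Finset.prod_le_prod
        (fun i _ => Finset.sum_nonneg fun x _ => hg0 x)
        fun i _ => hgs.sum_le_tsum _ fun x _ => hg0 x
    _ = S₀ ^ d := by simp

/-- The alternating sum `k₁ - k₂ + k₃ - ⋯` of a tuple of frequencies. -/
def altSum (d n : ℕ) (κ : Fin (2 * n + 1) → (Fin d → ℤ)) : Fin d → ℤ :=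
  ∑ j : Fin (2 * n + 1), ((-1 : ℤ) ^ (j : ℕ)) • κ j

lemma exists_lam_altSum_le (d n : ℕ) (κ : Fin (2 * n + 1) → (Fin d → ℤ)) :
    ∃ j, (lam d (altSum d n κ) : ℝ) ≤ (2 * n + 1 : ℝ) ^ 2 * lam d (κ j) := by
  obtain ⟨j, -, hj⟩ := Finset.exists_max_image (Finset.univ : Finset (Fin (2 * n + 1)))
    (fun j => lam d (κ j)) ⟨0, Finset.mem_univ _⟩
  refine ⟨j, ?_⟩
  have h1 : lam d (altSum d n κ) ≤ (2 * n + 1) * ∑ j, lam d (κ j) := by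
    unfold lam
    rw [Finset.sum_comm, Finset.mul_sum]
    refine Finset.sum_le_sum fun i _ => ?_
    have h := sq_sum_le_card_mul_sum_sq (s := (Finset.univ : Finset (Fin (2 * n + 1))))
      (f := fun j => ((-1 : ℤ) ^ (j : ℕ)) * κ j i)
    have hsq : ∀ j : Fin (2 * n + 1), ((-1 : ℤ) ^ (j : ℕ) * κ j i) ^ 2 = κ j i ^ 2 := by
      intro j
      rw [mul_pow, ← pow_mul, mul_comm (j : ℕ) 2, pow_mul, neg_one_sq, one_pow, one_mul]
    simp only [hsq] at h
    simpa [altSum, Finset.sum_apply] using h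
  have h2 : ∑ j, lam d (κ j) ≤ (2 * n + 1) * lam d (κ j) := by
    refine (Finset.sum_le_card_nsmul _ _ _ hj).trans (le_of_eq ?_)
    simp
  have h3 : lam d (altSum d n κ) ≤ (2 * n + 1) ^ 2 * lam d (κ j) := by nlinarith
  exact_mod_cast h3

lemma wt_altSum_le (d n : ℕ) (σ : ℝ) (hσ : 0 ≤ σ) (κ : Fin (2 * n + 1) → (Fin d → ℤ)) :
    wt d σ (altSum d n κ) ≤ ((2 * n + 1 : ℝ) ^ 2) ^ σ * ∑ j, wt d σ (κ j) := by
  obtain ⟨j, hj⟩ := exists_lam_altSum_le d n κ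
  have h1 : (1 : ℝ) ≤ ((2 * n + 1 : ℝ) ^ 2) ^ σ :=
    Real.one_le_rpow (one_le_pow₀ (by linarith [(Nat.cast_nonneg n : (0 : ℝ) ≤ n)])) hσ
  have h2 : wt d σ (altSum d n κ) ≤ ((2 * n + 1 : ℝ) ^ 2) ^ σ * wt d σ (κ j) := by
    unfold wt
    have := Real.rpow_le_rpow (lam_cast_nonneg _ _) hj hσ
    rw [Real.mul_rpow (by positivity) (lam_cast_nonneg _ _)] at this
    linarith
  refine h2.trans (mul_le_mul_of_nonneg_left ?_ (by positivity))
  exact Finset.single_le_sum (f := fun j => wt d σ (κ j)) (fun i _ => (wt_pos _ _ _).le)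
    (Finset.mem_univ j)
/-! ### Sequences bounded in `h^σ` -/

/-- `x` has `h^σ`-norm at most `A`. -/
def IsBd (d : ℕ) (σ : ℝ) (x : (Fin d → ℤ) → ℝ) (A : ℝ) : Prop :=
  ∀ K : Finset (Fin d → ℤ), ∑ k ∈ K, wt d σ k * x k ^ 2 ≤ A ^ 2

lemma IsBd.mono {d : ℕ} {σ : ℝ} {x y : (Fin d → ℤ) → ℝ} {A B : ℝ} (hx : IsBd d σ x A)
    (hy0 : ∀ k, 0 ≤ y k) (hyx : ∀ k, y k ≤ x k) (hA : 0 ≤ A) (hAB : A ≤ B) :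
    IsBd d σ y B := fun K => by
  calc ∑ k ∈ K, wt d σ k * y k ^ 2 ≤ ∑ k ∈ K, wt d σ k * x k ^ 2 :=
        Finset.sum_le_sum fun k _ => mul_le_mul_of_nonneg_left
          (pow_le_pow_left₀ (hy0 k) (hyx k) 2) (wt_pos d σ k).le
    _ ≤ A ^ 2 := hx K
    _ ≤ B ^ 2 := pow_le_pow_left₀ hA hAB 2

lemma IsBd.const_mul {d : ℕ} {σ : ℝ} {x : (Fin d → ℤ) → ℝ} {A : ℝ} (hx : IsBd d σ x A) (c : ℝ) :
    IsBd d σ (fun k => c * x k) (c * A) := fun K => by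
  calc ∑ k ∈ K, wt d σ k * (c * x k) ^ 2 = c ^ 2 * ∑ k ∈ K, wt d σ k * x k ^ 2 := by
        rw [Finset.mul_sum]; exact Finset.sum_congr rfl fun k _ => by ring
    _ ≤ c ^ 2 * A ^ 2 := mul_le_mul_of_nonneg_left (hx K) (sq_nonneg c)
    _ = (c * A) ^ 2 := by ring

lemma sum_weight_mul_le {ι : Type*} (K : Finset ι) (w x y : ι → ℝ) (hw : ∀ k, 0 ≤ w k)
    {A B : ℝ} (hA : 0 ≤ A) (hB : 0 ≤ B) (hx : ∑ k ∈ K, w k * x k ^ 2 ≤ A ^ 2)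
    (hy : ∑ k ∈ K, w k * y k ^ 2 ≤ B ^ 2) : ∑ k ∈ K, w k * (x k * y k) ≤ A * B := by
  have h := Finset.sum_mul_sq_le_sq_mul_sq K (fun k => √(w k) * x k) (fun k => √(w k) * y k)
  have e1 : ∀ k, √(w k) * x k * (√(w k) * y k) = w k * (x k * y k) := fun k => by
    nth_rewrite 3 [← Real.mul_self_sqrt (hw k)]; ring
  have e2 : ∀ z : ι → ℝ, ∀ k, (√(w k) * z k) ^ 2 = w k * z k ^ 2 := fun z k => by
    rw [mul_pow, Real.sq_sqrt (hw k)]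
  simp only [e1, e2] at h
  refine abs_le_of_sq_le_sq' ?_ (mul_nonneg hA hB) |>.2
  rw [mul_pow]
  refine h.trans (mul_le_mul hx hy ?_ (sq_nonneg A))
  exact Finset.sum_nonneg fun k _ => mul_nonneg (hw k) (sq_nonneg _)

lemma IsBd.add {d : ℕ} {σ : ℝ} {x y : (Fin d → ℤ) → ℝ} {A B : ℝ} (hx : IsBd d σ x A)
    (hy : IsBd d σ y B) (hA : 0 ≤ A) (hB : 0 ≤ B) :
    IsBd d σ (fun k => x k + y k) (A + B) := fun K => by
  have h := sum_weight_mul_le K (wt d σ) x y (fun k => (wt_pos d σ k).le) hA hB (hx K) (hy K)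
  calc ∑ k ∈ K, wt d σ k * (x k + y k) ^ 2
      = ∑ k ∈ K, wt d σ k * x k ^ 2 + 2 * ∑ k ∈ K, wt d σ k * (x k * y k)
          + ∑ k ∈ K, wt d σ k * y k ^ 2 := by
        rw [Finset.mul_sum, ← Finset.sum_add_distrib, ← Finset.sum_add_distrib]
        exact Finset.sum_congr rfl fun k _ => by ring
    _ ≤ A ^ 2 + 2 * (A * B) + B ^ 2 := by linarith [hx K, hy K]
    _ = (A + B) ^ 2 := by ring

lemma IsBd.zero {d : ℕ} {σ : ℝ} {A : ℝ} : IsBd d σ (fun _ => 0) A := fun K => by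
  simpa using sq_nonneg A

lemma IsBd.sum {d : ℕ} {σ : ℝ} {ι : Type*} (J : Finset ι) {x : ι → (Fin d → ℤ) → ℝ} {A : ℝ}
    (hA : 0 ≤ A) (hx : ∀ j ∈ J, IsBd d σ (x j) A) :
    IsBd d σ (fun k => ∑ j ∈ J, x j k) (J.card * A) := by
  classical
  induction J using Finset.induction_on with
  | empty => simpa using IsBd.zero
  | insert j J hj ih =>
    have h := (hx j (Finset.mem_insert_self _ _)).add
      (ih fun i hi => hx i (Finset.mem_insert_of_mem hi)) hA (by positivity)
    simp only [Finset.sum_insert hj, Finset.card_insert_of_notMem hj]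
    push_cast
    convert h using 1
    ring

lemma IsBd.of_tendsto {d : ℕ} {σ : ℝ} {ι : Type*} {l : Filter ι} [l.NeBot]
    {f : ι → (Fin d → ℤ) → ℝ} {x : (Fin d → ℤ) → ℝ} {A : ℝ} (hf : ∀ i, IsBd d σ (f i) A)
    (h : ∀ k, Filter.Tendsto (fun i => f i k) l (nhds (x k))) : IsBd d σ x A := fun K =>
  le_of_tendsto (tendsto_finsetSum K fun k _ => ((h k).pow 2).const_mul (wt d σ k))
    (Filter.Eventually.of_forall fun i => hf i K)

lemma IsBd.summable {d : ℕ} {σ : ℝ} {x : (Fin d → ℤ) → ℝ} {A : ℝ} (hx : IsBd d σ x A) :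
    Summable fun k => wt d σ k * x k ^ 2 :=
  summable_of_sum_le (fun k => mul_nonneg (wt_pos d σ k).le (sq_nonneg _)) hx

lemma IsBd.hnorm_le {d : ℕ} {σ : ℝ} {v : (Fin d → ℤ) → ℂ} {A : ℝ}
    (hv : IsBd d σ (fun k => ‖v k‖) A) (hA : 0 ≤ A) : hnorm d σ v ≤ A :=
  Real.sqrt_le_iff.2 ⟨hA, hv.summable.tsum_le_of_sum_le hv⟩

lemma memH.isBd {d : ℕ} {σ : ℝ} {v : (Fin d → ℤ) → ℂ} (hv : memH d σ v) :
    IsBd d σ (fun k => ‖v k‖) (hnorm d σ v) := fun K => by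
  have h0 : ∀ k, 0 ≤ wt d σ k * ‖v k‖ ^ 2 := fun k => mul_nonneg (wt_pos d σ k).le (sq_nonneg _)
  rw [hnorm, Real.sq_sqrt (tsum_nonneg h0)]
  exact hv.sum_le_tsum K fun k _ => h0 k

lemma hnorm_nonneg (d : ℕ) (σ : ℝ) (v : (Fin d → ℤ) → ℂ) : 0 ≤ hnorm d σ v := Real.sqrt_nonneg _

/-! ### Multilinear convolution estimate -/

/-- The summand of the alternating convolution of a family of real sequences. -/
noncomputable def convTerm (d n : ℕ) (f : Fin (2 * n + 1) → (Fin d → ℤ) → ℝ) (k : Fin d → ℤ)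
    (κ : Fin (2 * n + 1) → (Fin d → ℤ)) : ℝ :=
  if altSum d n κ = k then ∏ j, f j (κ j) else 0

lemma convTerm_nonneg {d n : ℕ} {f : Fin (2 * n + 1) → (Fin d → ℤ) → ℝ} (hf : ∀ j k, 0 ≤ f j k)
    (k : Fin d → ℤ) (κ : Fin (2 * n + 1) → (Fin d → ℤ)) : 0 ≤ convTerm d n f k κ := by
  unfold convTerm
  split_ifs
  · exact Finset.prod_nonneg fun j _ => hf j _
  · exact le_rfl

lemma altSum_inj_of_update {d n : ℕ} {κ κ' : Fin (2 * n + 1) → (Fin d → ℤ)}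
    (i : Fin (2 * n + 1)) (h : altSum d n κ = altSum d n κ')
    (hu : Function.update κ i 0 = Function.update κ' i 0) : κ = κ' := by
  have hne : ∀ j : Fin (2 * n + 1), j ≠ i → κ j = κ' j := fun j hj => by
    simpa [Function.update_of_ne hj] using congrFun hu j
  have hi : κ i = κ' i := by
    unfold altSum at h
    rw [← Finset.add_sum_erase _ _ (Finset.mem_univ i),
      ← Finset.add_sum_erase _ (fun j : Fin (2 * n + 1) => ((-1 : ℤ) ^ (j : ℕ)) • κ' j)
        (Finset.mem_univ i),
      Finset.sum_congr rfl fun j hj => by rw [hne j (Finset.ne_of_mem_erase hj)]] at h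
    have h2 := add_right_cancel h
    rcases neg_one_pow_eq_or ℤ (i : ℕ) with e | e
    · simpa [e] using h2
    · simpa [e] using h2
  funext j
  by_cases hj : j = i
  · rw [hj, hi]
  · exact hne j hj

/-- Sums over the tuples with given alternating sum of a product which omits one slot. -/
lemma sum_prod_erase_le {d n : ℕ} {g : (Fin d → ℤ) → ℝ} (hg : ∀ k, 0 ≤ g k) {S : ℝ} (hS : 1 ≤ S)
    (hgS : ∀ K : Finset (Fin d → ℤ), ∑ k ∈ K, g k ≤ S) (k : Fin d → ℤ) (i : Fin (2 * n + 1))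
    (Q : Finset (Fin (2 * n + 1) → (Fin d → ℤ))) :
    ∑ κ ∈ Q with altSum d n κ = k, ∏ j ∈ Finset.univ.erase i, g (κ j) ≤ S ^ (2 * n + 1) := by
  classical
  set G : Fin (2 * n + 1) → (Fin d → ℤ) → ℝ := fun j => if j = i then fun _ => 1 else g with hG
  have hG0 : ∀ j k, 0 ≤ G j k := fun j k => by
    by_cases h : j = i <;> simp [hG, h, hg]
  set Q' := Fintype.piFinset fun j => if j = i then {0} else Q.image fun κ => κ j with hQ'
  have hprod : ∀ κ : Fin (2 * n + 1) → (Fin d → ℤ),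
      ∏ j ∈ Finset.univ.erase i, g (κ j) = ∏ j, G j (Function.update κ i 0 j) := by
    intro κ
    rw [← Finset.mul_prod_erase _ _ (Finset.mem_univ i)]
    simp only [hG, if_true, one_mul]
    refine Finset.prod_congr rfl fun j hj => ?_
    rw [if_neg (Finset.ne_of_mem_erase hj), Function.update_of_ne (Finset.ne_of_mem_erase hj)]
  simp only [hprod]
  have hinj : Set.InjOn (fun κ : Fin (2 * n + 1) → (Fin d → ℤ) => Function.update κ i 0)
      (Q.filter fun κ => altSum d n κ = k) := by
    intro κ hκ κ' hκ' h
    simp only [Finset.coe_filter, Set.mem_ofPred_eq] at hκ hκ'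
    exact altSum_inj_of_update i (hκ.2.trans hκ'.2.symm) h
  rw [← Finset.sum_image (f := fun κ => ∏ j, G j (κ j)) hinj]
  calc _ ≤ ∑ κ ∈ Q', ∏ j, G j (κ j) := by
        refine Finset.sum_le_sum_of_subset_of_nonneg (fun κ hκ => ?_)
          fun κ _ _ => Finset.prod_nonneg fun j _ => hG0 j _
        obtain ⟨κ₀, hκ₀, rfl⟩ := Finset.mem_image.1 hκ
        rw [Fintype.mem_piFinset]
        intro j
        by_cases hj : j = i
        · subst hj; simp
        · simp only [hj, if_false, Function.update_of_ne hj]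
          exact Finset.mem_image_of_mem (fun κ => κ j) (Finset.mem_filter.1 hκ₀).1
    _ = ∏ j, ∑ x ∈ (if j = i then {0} else Q.image fun κ => κ j), G j x :=
        (Finset.prod_univ_sum _ _).symm
    _ ≤ ∏ _j : Fin (2 * n + 1), S := by
        refine Finset.prod_le_prod (fun j _ => Finset.sum_nonneg fun x _ => hG0 j x) fun j _ => ?_
        by_cases hj : j = i
        · simpa [hG, hj] using hS
        · simpa [hG, hj] using hgS _
    _ = S ^ (2 * n + 1) := by simp

/-- Algebra property of `h^σ`, `σ > d / 2`, for alternating convolutions. -/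
lemma exists_conv_bound (d n : ℕ) (hd : 1 ≤ d) (σ : ℝ) (hσ : (d : ℝ) / 2 < σ) :
    ∃ C : ℝ, 1 ≤ C ∧ ∀ (f : Fin (2 * n + 1) → (Fin d → ℤ) → ℝ) (A : Fin (2 * n + 1) → ℝ),
      (∀ j k, 0 ≤ f j k) → (∀ j, 0 ≤ A j) → (∀ j, IsBd d σ (f j) (A j)) →
      (∀ k, Summable (convTerm d n f k)) ∧
        IsBd d σ (fun k => ∑' κ, convTerm d n f k κ) (C * ∏ j, A j) := by
  classical
  have hσ0 : 0 ≤ σ := by have : (0 : ℝ) ≤ d := Nat.cast_nonneg d; linarith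
  obtain ⟨S, hS, hSK⟩ := exists_sum_inv_wt_le d hd σ hσ
  set D : ℝ := ((2 * n + 1 : ℝ) ^ 2) ^ σ * ((2 * n + 1) * S ^ (2 * n + 1)) with hD
  have hn1 : (1 : ℝ) ≤ 2 * n + 1 := by linarith [(Nat.cast_nonneg n : (0 : ℝ) ≤ n)]
  have hD1 : 1 ≤ D := one_le_mul_of_one_le_of_one_le
    (Real.one_le_rpow (one_le_pow₀ hn1) hσ0)
    (one_le_mul_of_one_le_of_one_le hn1 (one_le_pow₀ hS))
  refine ⟨√D, Real.one_le_sqrt.2 hD1, fun f A hf hA hfA => ?_⟩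
  have hwi : ∀ (k : Fin d → ℤ) (Q : Finset (Fin (2 * n + 1) → (Fin d → ℤ))),
      wt d σ k * ∑ κ ∈ Q with altSum d n κ = k, ∏ j, (wt d σ (κ j))⁻¹ ≤ D := by
    intro k Q
    calc wt d σ k * ∑ κ ∈ Q with altSum d n κ = k, ∏ j, (wt d σ (κ j))⁻¹
        ≤ ∑ κ ∈ Q with altSum d n κ = k, ((2 * n + 1 : ℝ) ^ 2) ^ σ *
            ∑ i, ∏ j ∈ Finset.univ.erase i, (wt d σ (κ j))⁻¹ := by
          rw [Finset.mul_sum]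
          refine Finset.sum_le_sum fun κ hκ => ?_
          have hk := (Finset.mem_filter.1 hκ).2
          have h1 := wt_altSum_le d n σ hσ0 κ
          rw [hk] at h1
          have hP : 0 ≤ ∏ j, (wt d σ (κ j))⁻¹ :=
            Finset.prod_nonneg fun j _ => inv_nonneg.2 (wt_pos _ _ _).le
          refine (mul_le_mul_of_nonneg_right h1 hP).trans (le_of_eq ?_)
          rw [mul_assoc, Finset.sum_mul]
          congr 1
          refine Finset.sum_congr rfl fun i _ => ?_
          rw [← Finset.mul_prod_erase _ _ (Finset.mem_univ i), ← mul_assoc,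
            mul_inv_cancel₀ (wt_pos _ _ _).ne', one_mul]
      _ = ((2 * n + 1 : ℝ) ^ 2) ^ σ * ∑ i, ∑ κ ∈ Q with altSum d n κ = k,
            ∏ j ∈ Finset.univ.erase i, (wt d σ (κ j))⁻¹ := by
          rw [← Finset.mul_sum, Finset.sum_comm]
      _ ≤ D := by
          rw [hD]
          refine mul_le_mul_of_nonneg_left ?_ (by positivity)
          refine (Finset.sum_le_card_nsmul _ _ (S ^ (2 * n + 1)) fun i _ => ?_).trans (le_of_eq ?_)
          · exact sum_prod_erase_le (fun k => inv_nonneg.2 (wt_pos _ _ _).le) hS hSK k i Q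
          · simp
  have hfin : ∀ Q : Finset (Fin (2 * n + 1) → (Fin d → ℤ)),
      IsBd d σ (fun k => ∑ κ ∈ Q, convTerm d n f k κ) (√D * ∏ j, A j) := by
    intro Q K
    set F : (Fin (2 * n + 1) → (Fin d → ℤ)) → ℝ := fun κ => ∏ j, wt d σ (κ j) * f j (κ j) ^ 2
      with hF
    have hF0 : ∀ κ, 0 ≤ F κ := fun κ =>
      Finset.prod_nonneg fun j _ => mul_nonneg (wt_pos _ _ _).le (sq_nonneg _)
    have hk : ∀ k, wt d σ k * (∑ κ ∈ Q, convTerm d n f k κ) ^ 2 ≤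
        D * ∑ κ ∈ Q with altSum d n κ = k, F κ := by
      intro k
      have e1 : ∑ κ ∈ Q, convTerm d n f k κ
          = ∑ κ ∈ Q with altSum d n κ = k, ∏ j, f j (κ j) := by
        rw [Finset.sum_filter]; rfl
      have hcs := Finset.sum_mul_sq_le_sq_mul_sq (Q.filter fun κ => altSum d n κ = k)
        (fun κ => √(∏ j, (wt d σ (κ j))⁻¹)) (fun κ => √(F κ))
      have e2 : ∀ κ : Fin (2 * n + 1) → (Fin d → ℤ),
          √(∏ j, (wt d σ (κ j))⁻¹) * √(F κ) = ∏ j, f j (κ j) := by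
        intro κ
        rw [← Real.sqrt_mul (Finset.prod_nonneg fun j _ => inv_nonneg.2 (wt_pos _ _ _).le), hF,
          ← Finset.prod_mul_distrib, ← Real.sqrt_sq (Finset.prod_nonneg fun j _ => hf j (κ j)),
          ← Finset.prod_pow]
        congr 1
        refine Finset.prod_congr rfl fun j _ => ?_
        rw [← mul_assoc, inv_mul_cancel₀ (wt_pos _ _ _).ne', one_mul]
      have e3 : ∀ κ : Fin (2 * n + 1) → (Fin d → ℤ),
          √(∏ j, (wt d σ (κ j))⁻¹) ^ 2 = ∏ j, (wt d σ (κ j))⁻¹ := fun κ =>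
        Real.sq_sqrt (Finset.prod_nonneg fun j _ => inv_nonneg.2 (wt_pos _ _ _).le)
      simp only [e2, e3, Real.sq_sqrt (hF0 _)] at hcs
      rw [e1]
      calc _ ≤ wt d σ k * ((∑ κ ∈ Q with altSum d n κ = k, ∏ j, (wt d σ (κ j))⁻¹) *
              ∑ κ ∈ Q with altSum d n κ = k, F κ) :=
            mul_le_mul_of_nonneg_left hcs (wt_pos _ _ _).le
        _ ≤ _ := by
            rw [← mul_assoc]
            exact mul_le_mul_of_nonneg_right (hwi k Q) (Finset.sum_nonneg fun κ _ => hF0 κ)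
    calc ∑ k ∈ K, wt d σ k * (∑ κ ∈ Q, convTerm d n f k κ) ^ 2
        ≤ ∑ k ∈ K, D * ∑ κ ∈ Q with altSum d n κ = k, F κ := Finset.sum_le_sum fun k _ => hk k
      _ = D * ∑ κ ∈ Q, ∑ k ∈ K, if altSum d n κ = k then F κ else 0 := by
          rw [← Finset.mul_sum, Finset.sum_comm]
          simp only [Finset.sum_filter]
      _ ≤ D * ∑ κ ∈ Q, F κ := by
          refine mul_le_mul_of_nonneg_left (Finset.sum_le_sum fun κ _ => ?_) (by linarith)
          rw [Finset.sum_ite_eq]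
          split_ifs
          · exact le_rfl
          · exact hF0 κ
      _ ≤ D * ∑ κ ∈ Fintype.piFinset fun j => Q.image fun κ => κ j, F κ := by
          refine mul_le_mul_of_nonneg_left ?_ (by linarith)
          refine Finset.sum_le_sum_of_subset_of_nonneg (fun κ hκ => ?_) fun κ _ _ => hF0 κ
          rw [Fintype.mem_piFinset]
          exact fun j => Finset.mem_image_of_mem (fun κ => κ j) hκ
      _ = D * ∏ j, ∑ x ∈ Q.image fun κ => κ j, wt d σ x * f j x ^ 2 := by
          rw [Finset.prod_univ_sum]
      _ ≤ D * ∏ j, A j ^ 2 := by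
          refine mul_le_mul_of_nonneg_left ?_ (by linarith)
          exact Finset.prod_le_prod (fun j _ => Finset.sum_nonneg fun x _ =>
            mul_nonneg (wt_pos _ _ _).le (sq_nonneg _)) fun j _ => hfA j _
      _ = (√D * ∏ j, A j) ^ 2 := by
          rw [mul_pow, Real.sq_sqrt (by linarith), Finset.prod_pow]
  have hsum : ∀ k, Summable (convTerm d n f k) := by
    intro k
    refine summable_of_sum_le (c := √D * ∏ j, A j) (convTerm_nonneg hf k) fun Q => ?_
    have h := hfin Q {k}
    rw [Finset.sum_singleton] at h
    have hA0 : 0 ≤ √D * ∏ j, A j :=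
      mul_nonneg (Real.sqrt_nonneg _) (Finset.prod_nonneg fun j _ => hA j)
    refine (abs_le_of_sq_le_sq' (le_trans ?_ h) hA0).2
    exact le_mul_of_one_le_left (sq_nonneg _) (one_le_wt _ _ _)
  exact ⟨hsum, IsBd.of_tendsto hfin fun k => (hsum k).hasSum⟩
/-! ### Multilinear sums with one distinguished slot -/

/-- The summand of the alternating convolution with `x` in one slot and `z` in the others,
summed over the position of the distinguished slot. -/
noncomputable def slotTerm (d n : ℕ) (x z : (Fin d → ℤ) → ℝ) (k : Fin d → ℤ)
    (κ : Fin (2 * n + 1) → (Fin d → ℤ)) : ℝ :=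
  if altSum d n κ = k then ∑ j, x (κ j) * ∏ i ∈ Finset.univ.erase j, z (κ i) else 0

/-- The sum over all tuples of `slotTerm`. -/
noncomputable def slotSum (d n : ℕ) (x z : (Fin d → ℤ) → ℝ) (k : Fin d → ℤ) : ℝ :=
  ∑' κ, slotTerm d n x z k κ

lemma slotTerm_nonneg {d n : ℕ} {x z : (Fin d → ℤ) → ℝ} (hx : ∀ k, 0 ≤ x k) (hz : ∀ k, 0 ≤ z k)
    (k : Fin d → ℤ) (κ : Fin (2 * n + 1) → (Fin d → ℤ)) : 0 ≤ slotTerm d n x z k κ := by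
  unfold slotTerm
  split_ifs
  · exact Finset.sum_nonneg fun j _ => mul_nonneg (hx _) (Finset.prod_nonneg fun i _ => hz _)
  · exact le_rfl

/-- The multilinear estimate for `slotSum` in `h^σ` with constant `C`. -/
def SlotBound (d n : ℕ) (σ C : ℝ) : Prop :=
  ∀ (x z : (Fin d → ℤ) → ℝ) (A B : ℝ), (∀ k, 0 ≤ x k) → (∀ k, 0 ≤ z k) → 0 ≤ A → 0 ≤ B →
    IsBd d σ x A → IsBd d σ z B →
    (∀ k, Summable (slotTerm d n x z k)) ∧ IsBd d σ (slotSum d n x z) (C * A * B ^ (2 * n))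

lemma exists_slotBound (d n : ℕ) (hd : 1 ≤ d) (σ : ℝ) (hσ : (d : ℝ) / 2 < σ) :
    ∃ C : ℝ, 1 ≤ C ∧ SlotBound d n σ C := by
  classical
  obtain ⟨C, hC, hCf⟩ := exists_conv_bound d n hd σ hσ
  have hn0 : (0 : ℝ) ≤ n := Nat.cast_nonneg n
  refine ⟨(2 * n + 1) * C, by nlinarith, fun x z A B hx hz hA hB hxA hzB => ?_⟩
  set f : Fin (2 * n + 1) → Fin (2 * n + 1) → (Fin d → ℤ) → ℝ :=
    fun j => Function.update (fun _ => z) j x with hf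
  have hterm : ∀ k, slotTerm d n x z k = fun κ => ∑ j, convTerm d n (f j) k κ := by
    intro k
    funext κ
    unfold slotTerm convTerm
    split_ifs with h
    · refine Finset.sum_congr rfl fun j _ => ?_
      rw [← Finset.mul_prod_erase _ _ (Finset.mem_univ j)]
      congr 1
      · simp [hf]
      · refine Finset.prod_congr rfl fun i hi => ?_
        simp [hf, Function.update_of_ne (Finset.ne_of_mem_erase hi)]
    · simp
  have hj : ∀ j, (∀ k, Summable (convTerm d n (f j) k)) ∧
      IsBd d σ (fun k => ∑' κ, convTerm d n (f j) k κ) (C * (A * B ^ (2 * n))) := by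
    intro j
    have h := hCf (f j) (Function.update (fun _ => B) j A) ?_ ?_ ?_
    · refine ⟨h.1, ?_⟩
      have e : ∏ i, Function.update (fun _ => B) j A i = A * B ^ (2 * n) := by
        rw [← Finset.mul_prod_erase _ _ (Finset.mem_univ j), Function.update_self,
          Finset.prod_congr rfl fun i hi => Function.update_of_ne (Finset.ne_of_mem_erase hi) _ _,
          Finset.prod_const, Finset.card_erase_of_mem (Finset.mem_univ j)]
        simp
      rw [← e]; exact h.2
    all_goals
      intro i
      by_cases hij : i = j
      · subst hij; simp [hf]; assumption
      · simp [hf, Function.update_of_ne hij]; assumption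
  refine ⟨fun k => ?_, ?_⟩
  · rw [hterm k]
    exact summable_sum fun j _ => (hj j).1 k
  · have h := IsBd.sum Finset.univ (by positivity) fun j _ => (hj j).2
    have e1 : (slotSum d n x z) = fun k => ∑ j, ∑' κ, convTerm d n (f j) k κ := by
      funext k
      rw [slotSum, hterm k]
      exact Summable.tsum_finsetSum fun j _ => (hj j).1 k
    rw [e1]
    convert h using 1
    simp; ring

lemma norm_sum_le_slotSum {d n : ℕ} {x z : (Fin d → ℤ) → ℝ} (hx : ∀ k, 0 ≤ x k)
    (hz : ∀ k, 0 ≤ z k) {k : Fin d → ℤ} (hs : Summable (slotTerm d n x z k))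
    (Q : Finset (Fin (2 * n + 1) → (Fin d → ℤ))) (c : (Fin (2 * n + 1) → (Fin d → ℤ)) → ℂ)
    (hc : ∀ κ ∈ Q, ‖c κ‖ ≤ slotTerm d n x z k κ) : ‖∑ κ ∈ Q, c κ‖ ≤ slotSum d n x z k :=
  (norm_sum_le_of_le Q hc).trans (hs.sum_le_tsum Q fun κ _ => slotTerm_nonneg hx hz k κ)

lemma norm_prod_sub_prod_le {ι : Type*} [DecidableEq ι] (J : Finset ι) (f g : ι → ℂ) :
    ‖∏ j ∈ J, f j - ∏ j ∈ J, g j‖ ≤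
      ∑ j ∈ J, ‖f j - g j‖ * ∏ i ∈ J.erase j, (‖f i‖ + ‖g i‖) := by
  induction J using Finset.induction_on with
  | empty => simp
  | insert a J ha ih =>
    rw [Finset.prod_insert ha, Finset.prod_insert ha, Finset.sum_insert ha, Finset.erase_insert ha]
    have e : f a * ∏ j ∈ J, f j - g a * ∏ j ∈ J, g j
        = (f a - g a) * ∏ j ∈ J, f j + g a * (∏ j ∈ J, f j - ∏ j ∈ J, g j) := by ring
    rw [e]
    refine (norm_add_le _ _).trans (add_le_add ?_ ?_)
    · rw [norm_mul, norm_prod]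
      refine mul_le_mul_of_nonneg_left ?_ (norm_nonneg _)
      exact Finset.prod_le_prod (fun _ _ => norm_nonneg _)
        fun i _ => le_add_of_nonneg_right (norm_nonneg _)
    · rw [norm_mul]
      calc ‖g a‖ * ‖∏ j ∈ J, f j - ∏ j ∈ J, g j‖
          ≤ (‖f a‖ + ‖g a‖) * ∑ j ∈ J, ‖f j - g j‖ * ∏ i ∈ J.erase j, (‖f i‖ + ‖g i‖) :=
            mul_le_mul (le_add_of_nonneg_left (norm_nonneg _)) ih (norm_nonneg _) (by positivity)
        _ = _ := by
            rw [Finset.mul_sum]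
            refine Finset.sum_congr rfl fun j hj => ?_
            have hja : a ≠ j := fun h => ha (h ▸ hj)
            rw [Finset.erase_insert_of_ne hja, Finset.prod_insert
              fun h => ha (Finset.mem_of_mem_erase h)]
            ring

/-! ### Monomials and multiplier sums -/

/-- The factor in slot `j` of the monomials of `Pterm`. -/
noncomputable def slotFactor (j : ℕ) (z : ℂ) : ℂ := if Even j then z else (starRingEnd ℂ) z

@[simp] lemma norm_slotFactor (j : ℕ) (z : ℂ) : ‖slotFactor j z‖ = ‖z‖ := by
  unfold slotFactor; split_ifs <;> simp

lemma slotFactor_sub (j : ℕ) (z w : ℂ) :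
    slotFactor j z - slotFactor j w = slotFactor j (z - w) := by
  unfold slotFactor; split_ifs <;> simp

lemma slotFactor_mul (j : ℕ) (z w : ℂ) :
    slotFactor j (z * w) = slotFactor j z * slotFactor j w := by
  unfold slotFactor; split_ifs <;> simp

lemma HasDerivWithinAt.slotFactor {f : ℝ → ℂ} {f' : ℂ} {s : Set ℝ} {t : ℝ}
    (hf : HasDerivWithinAt f f' s t) (j : ℕ) :
    HasDerivWithinAt (fun r => slotFactor j (f r)) (slotFactor j f') s t := by
  unfold _root_.slotFactor
  split_ifs
  · exact hf
  · exact hf.star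

lemma Pterm_eq (d n : ℕ) (v : (Fin d → ℤ) → ℂ) (k : Fin d → ℤ)
    (κ : Fin (2 * n + 1) → (Fin d → ℤ)) :
    Pterm d n v k κ =
      if altSum d n κ = k then ∏ j : Fin (2 * n + 1), slotFactor j (v (κ j)) else 0 := rfl

lemma norm_Pterm_sub_le (d n : ℕ) (u v : (Fin d → ℤ) → ℂ) (k : Fin d → ℤ)
    (κ : Fin (2 * n + 1) → (Fin d → ℤ)) :
    ‖Pterm d n u k κ - Pterm d n v k κ‖ ≤
      slotTerm d n (fun k => ‖u k - v k‖) (fun k => ‖u k‖ + ‖v k‖) k κ := by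
  rw [Pterm_eq, Pterm_eq, slotTerm]
  split_ifs
  · refine (norm_prod_sub_prod_le _ _ _).trans (le_of_eq ?_)
    simp [slotFactor_sub]
  · simp

lemma Pterm_zero (d n : ℕ) (k : Fin d → ℤ) (κ : Fin (2 * n + 1) → (Fin d → ℤ)) :
    Pterm d n (fun _ => 0) k κ = 0 := by
  rw [Pterm_eq]
  split_ifs
  · exact Finset.prod_eq_zero (Finset.mem_univ 0) (by simp [slotFactor])
  · rfl

lemma norm_Pterm_le (d n : ℕ) (u : (Fin d → ℤ) → ℂ) (k : Fin d → ℤ)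
    (κ : Fin (2 * n + 1) → (Fin d → ℤ)) :
    ‖Pterm d n u k κ‖ ≤ slotTerm d n (fun k => ‖u k‖) (fun k => ‖u k‖) k κ := by
  simpa [Pterm_zero] using norm_Pterm_sub_le d n u (fun _ => 0) k κ

/-- The sum of the monomials of `Pterm` weighted by a multiplier `θ`. -/
noncomputable def msum (d n : ℕ) (θ : (Fin (2 * n + 1) → (Fin d → ℤ)) → ℂ) (v : (Fin d → ℤ) → ℂ)
    (k : Fin d → ℤ) : ℂ :=
  ∑' κ, θ κ * Pterm d n v k κ

lemma summable_msum {d n : ℕ} {σ C : ℝ} (hC : SlotBound d n σ C)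
    {θ : (Fin (2 * n + 1) → (Fin d → ℤ)) → ℂ} (hθ : ∀ κ, ‖θ κ‖ ≤ 1)
    {u : (Fin d → ℤ) → ℂ} {A : ℝ} (hA : 0 ≤ A) (hu : IsBd d σ (fun k => ‖u k‖) A)
    (k : Fin d → ℤ) : Summable fun κ => θ κ * Pterm d n u k κ := by
  have h := (hC _ _ A A (fun k => norm_nonneg (u k)) (fun k => norm_nonneg (u k)) hA hA hu hu).1 k
  refine Summable.of_norm_bounded h fun κ => ?_
  rw [norm_mul]
  exact (mul_le_of_le_one_left (norm_nonneg _) (hθ κ)).trans (norm_Pterm_le d n u k κ)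

lemma isBd_msum_sub {d n : ℕ} {σ C : ℝ} (hC0 : 0 ≤ C) (hC : SlotBound d n σ C)
    {θ : (Fin (2 * n + 1) → (Fin d → ℤ)) → ℂ} (hθ : ∀ κ, ‖θ κ‖ ≤ 1)
    {u v : (Fin d → ℤ) → ℂ} {A W : ℝ} (hA : 0 ≤ A) (hW : 0 ≤ W)
    (hu : IsBd d σ (fun k => ‖u k‖) A) (hv : IsBd d σ (fun k => ‖v k‖) A)
    (huv : IsBd d σ (fun k => ‖u k - v k‖) W) :
    IsBd d σ (fun k => ‖msum d n θ u k - msum d n θ v k‖) (C * W * (2 * A) ^ (2 * n)) := by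
  have h := hC _ _ W (2 * A) (fun k => norm_nonneg (u k - v k))
    (fun k => add_nonneg (norm_nonneg (u k)) (norm_nonneg (v k))) hW (by positivity) huv
    (by rw [two_mul]; exact hu.add hv hA hA)
  refine h.2.mono (fun k => norm_nonneg _) (fun k => ?_) (by positivity) le_rfl
  rw [msum, msum, ← (summable_msum hC hθ hA hu k).tsum_sub (summable_msum hC hθ hA hv k)]
  refine tsum_of_norm_bounded (h.1 k).hasSum fun κ => ?_
  rw [← mul_sub, norm_mul]
  exact (mul_le_of_le_one_left (norm_nonneg _) (hθ κ)).trans (norm_Pterm_sub_le d n u v k κ)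

lemma isBd_msum {d n : ℕ} {σ C : ℝ} (hC0 : 0 ≤ C) (hC : SlotBound d n σ C)
    {θ : (Fin (2 * n + 1) → (Fin d → ℤ)) → ℂ} (hθ : ∀ κ, ‖θ κ‖ ≤ 1)
    {u : (Fin d → ℤ) → ℂ} {A : ℝ} (hA : 0 ≤ A) (hu : IsBd d σ (fun k => ‖u k‖) A) :
    IsBd d σ (fun k => ‖msum d n θ u k‖) (C * A * (2 * A) ^ (2 * n)) := by
  have h := isBd_msum_sub (v := fun _ => 0) hC0 hC hθ hA hA hu (by simpa using IsBd.zero)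
    (by simpa using hu)
  simpa [msum, Pterm_zero] using h

/-- The restriction of a sequence to the frequencies in `K`. -/
def trunc {d : ℕ} (K : Finset (Fin d → ℤ)) (v : (Fin d → ℤ) → ℂ) (k : Fin d → ℤ) : ℂ :=
  if k ∈ K then v k else 0

lemma norm_trunc_le {d : ℕ} (K : Finset (Fin d → ℤ)) (v : (Fin d → ℤ) → ℂ) (k : Fin d → ℤ) :
    ‖trunc K v k‖ ≤ ‖v k‖ := by
  unfold trunc; split_ifs <;> simp

lemma msum_trunc (d n : ℕ) (θ : (Fin (2 * n + 1) → (Fin d → ℤ)) → ℂ) (K : Finset (Fin d → ℤ))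
    (v : (Fin d → ℤ) → ℂ) (k : Fin d → ℤ) :
    msum d n θ (trunc K v) k =
      ∑ κ ∈ Fintype.piFinset fun _ : Fin (2 * n + 1) => K, θ κ * Pterm d n v k κ := by
  rw [msum, tsum_eq_sum (s := Fintype.piFinset fun _ : Fin (2 * n + 1) => K)]
  · refine Finset.sum_congr rfl fun κ hκ => ?_
    rw [Fintype.mem_piFinset] at hκ
    simp [Pterm_eq, trunc, hκ]
  · intro κ hκ
    rw [Fintype.mem_piFinset, not_forall] at hκ
    obtain ⟨j, hj⟩ := hκ
    rw [Pterm_eq]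
    split_ifs
    · rw [Finset.prod_eq_zero (Finset.mem_univ j) (by simp [trunc, hj, slotFactor]), mul_zero]
    · exact mul_zero _

/-! ### Resonances and the normal form correction -/

/-- The resonance defect of a tuple of frequencies. -/
def defect (d n : ℕ) (κ : Fin (2 * n + 1) → (Fin d → ℤ)) : ℤ :=
  ∑ j : Fin (2 * n + 1), ((-1 : ℤ) ^ (j : ℕ)) * lam d (κ j) - lam d (altSum d n κ)

/-- The oscillating multiplier `exp(i ω Ω)`, with `Ω` the resonance defect. -/
noncomputable def oscMul (d n : ℕ) (ω : ℝ) (κ : Fin (2 * n + 1) → (Fin d → ℤ)) : ℂ :=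
  Complex.exp (Complex.I * (ω * (defect d n κ : ℂ)))

/-- The multiplier selecting the resonant tuples. -/
noncomputable def resMul (d n : ℕ) (κ : Fin (2 * n + 1) → (Fin d → ℤ)) : ℂ :=
  if defect d n κ = 0 then 1 else 0

/-- The nonresonant part of `oscMul`. -/
noncomputable def nonresMul (d n : ℕ) (ω : ℝ) (κ : Fin (2 * n + 1) → (Fin d → ℤ)) : ℂ :=
  if defect d n κ = 0 then 0 else oscMul d n ω κ

lemma norm_oscMul (d n : ℕ) (ω : ℝ) (κ : Fin (2 * n + 1) → (Fin d → ℤ)) :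
    ‖oscMul d n ω κ‖ = 1 := by
  have : Complex.I * (ω * (defect d n κ : ℂ)) = ((ω * defect d n κ : ℝ) : ℂ) * Complex.I := by
    push_cast; ring
  rw [oscMul, this, Complex.norm_exp_ofReal_mul_I]

lemma norm_resMul_le (d n : ℕ) (κ : Fin (2 * n + 1) → (Fin d → ℤ)) : ‖resMul d n κ‖ ≤ 1 := by
  unfold resMul; split_ifs <;> simp

lemma norm_nonresMul_le (d n : ℕ) (ω : ℝ) (κ : Fin (2 * n + 1) → (Fin d → ℤ)) :
    ‖nonresMul d n ω κ‖ ≤ 1 := by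
  unfold nonresMul; split_ifs <;> simp [norm_oscMul]

lemma oscMul_eq (d n : ℕ) (ω : ℝ) (κ : Fin (2 * n + 1) → (Fin d → ℤ)) :
    oscMul d n ω κ = resMul d n κ + nonresMul d n ω κ := by
  unfold resMul nonresMul
  split_ifs with h <;> simp [oscMul, h]

lemma Rk_eq_msum (d n : ℕ) (v : (Fin d → ℤ) → ℂ) (k : Fin d → ℤ) :
    Rk d n v k = msum d n (resMul d n) v k := by
  rw [Rk, msum]
  refine tsum_congr fun κ => ?_
  rw [Pterm_eq]
  change (if altSum d n κ = k ∧ _ then _ else _) = _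
  by_cases h : altSum d n κ = k
  · have h2 : (∑ j : Fin (2 * n + 1), ((-1 : ℤ) ^ (j : ℕ)) * lam d (κ j)) = lam d k ↔
        defect d n κ = 0 := by
      rw [defect, h, sub_eq_zero]
    simp only [h, true_and, if_true, h2, resMul]
    split_ifs
    · rw [one_mul]; rfl
    · rw [zero_mul]
  · simp [h]

/-- The integrated multiplier `nonresMul / (i Ω)`. -/
noncomputable def intMul (d n : ℕ) (ω : ℝ) (κ : Fin (2 * n + 1) → (Fin d → ℤ)) : ℂ :=
  nonresMul d n ω κ / (Complex.I * (defect d n κ : ℂ))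

lemma norm_intMul_le (d n : ℕ) (ω : ℝ) (κ : Fin (2 * n + 1) → (Fin d → ℤ)) :
    ‖intMul d n ω κ‖ ≤ 1 := by
  unfold intMul nonresMul
  split_ifs with h
  · simp
  · rw [norm_div, norm_oscMul, norm_mul, Complex.norm_I, one_mul, Complex.norm_intCast]
    refine div_le_one_of_le₀ ?_ (abs_nonneg _)
    exact_mod_cast Int.one_le_abs h

/-- The derivative of `intMul` along `ω = t / ε`. -/
lemma hasDerivAt_intMul (d n : ℕ) (ε t : ℝ) (κ : Fin (2 * n + 1) → (Fin d → ℤ)) :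
    HasDerivAt (fun r : ℝ => intMul d n (r / ε) κ)
      ((ε : ℂ)⁻¹ * nonresMul d n (t / ε) κ) t := by
  unfold intMul nonresMul oscMul
  split_ifs with h
  · simpa using hasDerivAt_const t (0 : ℂ)
  · have hΩ : (defect d n κ : ℂ) ≠ 0 := by exact_mod_cast h
    have h1 : HasDerivAt (fun r : ℝ => Complex.I * (((r / ε : ℝ) : ℂ) * (defect d n κ : ℂ)))
        (Complex.I * ((ε : ℂ)⁻¹ * (defect d n κ : ℂ))) t := by
      have h0 : HasDerivAt (fun r : ℝ => ((r / ε : ℝ) : ℂ)) (((1 / ε : ℝ)) : ℂ) t :=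
        ((hasDerivAt_id t).div_const ε).ofReal_comp
      have := (h0.mul_const (defect d n κ : ℂ)).const_mul Complex.I
      simpa using this
    have h2 := (h1.cexp).div_const (Complex.I * (defect d n κ : ℂ))
    refine h2.congr_deriv ?_
    rw [div_eq_iff (mul_ne_zero Complex.I_ne_zero hΩ)]
    ring

/-- The normal form correction. -/
noncomputable def nfSum (d n : ℕ) (K : Finset (Fin d → ℤ)) (ω : ℝ) (u : (Fin d → ℤ) → ℂ)
    (k : Fin d → ℤ) : ℂ :=
  ∑ κ ∈ Fintype.piFinset fun _ : Fin (2 * n + 1) => K, intMul d n ω κ * Pterm d n u k κ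

/-- The derivative of `Pterm` along a curve with velocity `u'`. -/
noncomputable def dPterm (d n : ℕ) (u u' : (Fin d → ℤ) → ℂ) (k : Fin d → ℤ)
    (κ : Fin (2 * n + 1) → (Fin d → ℤ)) : ℂ :=
  if altSum d n κ = k then
    ∑ j : Fin (2 * n + 1), (∏ i ∈ Finset.univ.erase j, slotFactor i (u (κ i))) *
      slotFactor j (u' (κ j))
  else 0

/-- The part of the derivative of `nfSum` in which the derivative falls on the monomial. -/
noncomputable def nfDer (d n : ℕ) (K : Finset (Fin d → ℤ)) (ω : ℝ) (u u' : (Fin d → ℤ) → ℂ)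
    (k : Fin d → ℤ) : ℂ :=
  ∑ κ ∈ Fintype.piFinset fun _ : Fin (2 * n + 1) => K, intMul d n ω κ * dPterm d n u u' k κ

lemma hasDerivWithinAt_nfSum (d n : ℕ) (K : Finset (Fin d → ℤ)) (ε : ℝ)
    (u : ℝ → (Fin d → ℤ) → ℂ) (u' : (Fin d → ℤ) → ℂ) (s : Set ℝ) (t : ℝ)
    (hu : ∀ k, HasDerivWithinAt (fun r => u r k) (u' k) s t) (k : Fin d → ℤ) :
    HasDerivWithinAt (fun r => nfSum d n K (r / ε) (u r) k)
      ((ε : ℂ)⁻¹ * msum d n (nonresMul d n (t / ε)) (trunc K (u t)) k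
        + nfDer d n K (t / ε) (u t) u' k) s t := by
  have hP : ∀ κ : Fin (2 * n + 1) → (Fin d → ℤ),
      HasDerivWithinAt (fun r => Pterm d n (u r) k κ) (dPterm d n (u t) u' k κ) s t := by
    intro κ
    simp only [Pterm_eq, dPterm]
    split_ifs
    · have := HasDerivWithinAt.fun_finsetProd (u := (Finset.univ : Finset (Fin (2 * n + 1))))
        (f := fun j r => slotFactor j (u r (κ j))) fun j _ => (hu (κ j)).slotFactor j
      simpa using this
    · exact hasDerivWithinAt_const _ _ _
  have h := HasDerivWithinAt.fun_sum (u := Fintype.piFinset fun _ : Fin (2 * n + 1) => K)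
    fun κ _ => ((hasDerivAt_intMul d n ε t κ).hasDerivWithinAt (s := s)).mul (hP κ)
  refine HasDerivWithinAt.congr_deriv h ?_
  rw [msum_trunc, nfDer, Finset.mul_sum, ← Finset.sum_add_distrib]
  exact Finset.sum_congr rfl fun κ _ => by ring
lemma isBd_nfSum {d n : ℕ} {σ C : ℝ} (hC0 : 0 ≤ C) (hC : SlotBound d n σ C)
    (K : Finset (Fin d → ℤ)) (ω : ℝ) {u : (Fin d → ℤ) → ℂ} {A : ℝ} (hA : 0 ≤ A)
    (hu : IsBd d σ (fun k => ‖u k‖) A) :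
    IsBd d σ (fun k => ‖nfSum d n K ω u k‖) (C * A * A ^ (2 * n)) := by
  have h := hC _ _ A A (fun k => norm_nonneg (u k)) (fun k => norm_nonneg (u k)) hA hA hu hu
  refine h.2.mono (fun k => norm_nonneg _) (fun k => ?_) (by positivity) le_rfl
  refine norm_sum_le_slotSum (fun k => norm_nonneg (u k)) (fun k => norm_nonneg (u k)) (h.1 k) _ _
    fun κ _ => ?_
  rw [norm_mul]
  exact (mul_le_of_le_one_left (norm_nonneg _) (norm_intMul_le d n ω κ)).trans
    (norm_Pterm_le d n u k κ)

lemma isBd_nfSum_damped {d n : ℕ} {σ C : ℝ} (hC0 : 0 ≤ C) (hC : SlotBound d n σ C)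
    (K : Finset (Fin d → ℤ)) (ω : ℝ) {u : (Fin d → ℤ) → ℂ} {A δ ν : ℝ} (m : ℕ) (hA : 0 ≤ A)
    (hδ : 0 ≤ δ) (hν : 0 ≤ ν) (hu : IsBd d σ (fun k => ‖u k‖) A)
    (hud : IsBd d σ (fun k => ν * (lam d k : ℝ) ^ m * ‖trunc K u k‖) δ) :
    IsBd d σ (fun k => ν * (lam d k : ℝ) ^ m * ‖nfSum d n K ω u k‖)
      (C * (((2 * n + 1 : ℝ) ^ 2) ^ m * δ) * A ^ (2 * n)) := by
  have hx0 : ∀ k, 0 ≤ ((2 * n + 1 : ℝ) ^ 2) ^ m * (ν * (lam d k : ℝ) ^ m * ‖trunc K u k‖) :=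
    fun k => by have := lam_cast_nonneg d k; positivity
  have h := hC _ _ _ A hx0 (fun k => norm_nonneg (u k)) (by positivity) hA (hud.const_mul _) hu
  refine h.2.mono (fun k => ?_) (fun k => ?_) (by positivity) le_rfl
  · have := lam_cast_nonneg d k
    positivity
  have hlk : 0 ≤ ν * (lam d k : ℝ) ^ m := by have := lam_cast_nonneg d k; positivity
  have e : ν * (lam d k : ℝ) ^ m * ‖nfSum d n K ω u k‖ =
      ‖∑ κ ∈ Fintype.piFinset fun _ : Fin (2 * n + 1) => K,
        ((ν * (lam d k : ℝ) ^ m : ℝ) : ℂ) * (intMul d n ω κ * Pterm d n u k κ)‖ := by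
    rw [← Finset.mul_sum, norm_mul, Complex.norm_real, Real.norm_of_nonneg hlk, nfSum]
  rw [e]
  refine norm_sum_le_slotSum hx0 (fun k => norm_nonneg (u k)) (h.1 k) _ _ fun κ hκ => ?_
  rw [Fintype.mem_piFinset] at hκ
  rw [norm_mul, norm_mul, Complex.norm_real, Real.norm_of_nonneg hlk]
  refine (mul_le_mul_of_nonneg_left (mul_le_of_le_one_left (norm_nonneg _)
    (norm_intMul_le d n ω κ)) hlk).trans ?_
  rw [Pterm_eq, slotTerm]
  split_ifs with hk
  · obtain ⟨j, hj⟩ := exists_lam_altSum_le d n κ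
    rw [hk] at hj
    refine le_trans ?_ (Finset.single_le_sum (fun i _ => mul_nonneg (hx0 (κ i))
      (Finset.prod_nonneg fun i _ => norm_nonneg (u (κ i)))) (Finset.mem_univ j))
    rw [norm_prod, ← Finset.mul_prod_erase _ _ (Finset.mem_univ j), ← mul_assoc]
    simp only [norm_slotFactor, trunc, hκ, if_true]
    refine mul_le_mul_of_nonneg_right ?_ (Finset.prod_nonneg fun i _ => norm_nonneg _)
    rw [← mul_assoc]
    refine mul_le_mul_of_nonneg_right ?_ (norm_nonneg _)
    calc ν * (lam d k : ℝ) ^ m ≤ ν * ((2 * n + 1 : ℝ) ^ 2 * lam d (κ j)) ^ m :=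
          mul_le_mul_of_nonneg_left (pow_le_pow_left₀ (lam_cast_nonneg d k) hj m) hν
      _ = _ := by rw [mul_pow]; ring
  · simp

lemma isBd_nfDer {d n : ℕ} {σ C : ℝ} (hC0 : 0 ≤ C) (hC : SlotBound d n σ C)
    (K : Finset (Fin d → ℤ)) (ω : ℝ) {u u' : (Fin d → ℤ) → ℂ} {A D : ℝ} (hA : 0 ≤ A)
    (hD : 0 ≤ D) (hu : IsBd d σ (fun k => ‖u k‖) A)
    (hu' : IsBd d σ (fun k => ‖trunc K u' k‖) D) :
    IsBd d σ (fun k => ‖nfDer d n K ω u u' k‖) (C * D * A ^ (2 * n)) := by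
  have h := hC _ _ D A (fun k => norm_nonneg (trunc K u' k)) (fun k => norm_nonneg (u k))
    hD hA hu' hu
  refine h.2.mono (fun k => norm_nonneg _) (fun k => ?_) (by positivity) le_rfl
  refine norm_sum_le_slotSum (fun k => norm_nonneg _) (fun k => norm_nonneg (u k)) (h.1 k) _ _
    fun κ hκ => ?_
  rw [Fintype.mem_piFinset] at hκ
  rw [norm_mul]
  refine (mul_le_of_le_one_left (norm_nonneg _) (norm_intMul_le d n ω κ)).trans ?_
  rw [dPterm, slotTerm]
  split_ifs
  · refine (norm_sum_le _ _).trans (Finset.sum_le_sum fun j _ => le_of_eq ?_)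
    rw [norm_mul, norm_prod, mul_comm]
    simp only [norm_slotFactor, trunc, hκ, if_true]
  · simp

/-- The remainder in the normal form equation, for a nonlinearity of degree `2n+1`. -/
noncomputable def nfRem (d n m : ℕ) (K : Finset (Fin d → ℤ)) (ε ω μ : ℝ)
    (u u' du : (Fin d → ℤ) → ℂ) (k : Fin d → ℤ) : ℂ :=
  (msum d n (resMul d n) u k - msum d n (resMul d n) u' k)
    + (msum d n (nonresMul d n ω) u k - msum d n (nonresMul d n ω) (trunc K u) k)
    - (ε : ℂ) * nfDer d n K ω u du k
    - ((ε * μ * (lam d k : ℝ) ^ m : ℝ) : ℂ) * nfSum d n K ω u k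

lemma isBd_nfRem {d n : ℕ} {σ C : ℝ} (hC0 : 0 ≤ C) (hC : SlotBound d n σ C) (m : ℕ)
    (K : Finset (Fin d → ℤ)) {ε μ : ℝ} (ω : ℝ) (hε : 0 ≤ ε) (hμ : 0 ≤ μ)
    {u u' du : (Fin d → ℤ) → ℂ} {A W δ D : ℝ} (hA : 0 ≤ A) (hW : 0 ≤ W) (hδ : 0 ≤ δ) (hD : 0 ≤ D)
    (hu : IsBd d σ (fun k => ‖u k‖) A) (hu' : IsBd d σ (fun k => ‖u' k‖) A)
    (huu' : IsBd d σ (fun k => ‖u k - u' k‖) W)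
    (htail : IsBd d σ (fun k => ‖u k - trunc K u k‖) δ)
    (hdamp : IsBd d σ (fun k => ε * μ * (lam d k : ℝ) ^ m * ‖trunc K u k‖) δ)
    (hdu : IsBd d σ (fun k => ‖trunc K du k‖) D) :
    IsBd d σ (fun k => ‖nfRem d n m K ε ω μ u u' du k‖)
      (C * (2 * A) ^ (2 * n) * (W + δ + ε * D + ((2 * n + 1 : ℝ) ^ 2) ^ m * δ)) := by
  have h1 := isBd_msum_sub hC0 hC (norm_resMul_le d n) hA hW hu hu' huu'
  have h2 := isBd_msum_sub hC0 hC (norm_nonresMul_le d n ω) hA hδ hu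
    (hu.mono (fun k => norm_nonneg _) (norm_trunc_le K u) hA le_rfl) htail
  have h3 := (isBd_nfDer hC0 hC K ω hA hD hu hdu).const_mul ε
  have h4 := isBd_nfSum_damped hC0 hC K ω m hA hδ (mul_nonneg hε hμ) hu hdamp
  have h := ((h1.add h2 (by positivity) (by positivity)).add h3 (by positivity)
    (by positivity)).add h4 (by positivity) (by positivity)
  have hA2 : A ^ (2 * n) ≤ (2 * A) ^ (2 * n) := pow_le_pow_left₀ hA (by linarith) _
  refine h.mono (fun k => norm_nonneg _) (fun k => ?_) (by positivity) ?_
  · unfold nfRem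
    refine (norm_sub_le _ _).trans (add_le_add ((norm_sub_le _ _).trans
      (add_le_add (norm_add_le _ _) (le_of_eq ?_))) (le_of_eq ?_))
    · rw [norm_mul, Complex.norm_real, Real.norm_of_nonneg hε]
    · have := lam_cast_nonneg d k
      rw [norm_mul, Complex.norm_real, Real.norm_of_nonneg (by positivity)]
  · have e : C * (2 * A) ^ (2 * n) * (W + δ + ε * D + ((2 * n + 1 : ℝ) ^ 2) ^ m * δ) =
        C * W * (2 * A) ^ (2 * n) + C * δ * (2 * A) ^ (2 * n) + ε * (C * D * (2 * A) ^ (2 * n))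
          + C * (((2 * n + 1 : ℝ) ^ 2) ^ m * δ) * (2 * A) ^ (2 * n) := by ring
    rw [e]
    gcongr

/-! ### Energy inequality -/

lemma le_gronwallBound_of_weighted_energy {ι : Type*} (K : Finset ι) (w ν : ι → ℝ)
    (hw : ∀ k, 0 ≤ w k) {ν₀ : ℝ} (hν : ∀ k ∈ K, ν₀ ≤ ν k) {t₀ : ℝ} {y g : ℝ → ι → ℂ}
    (hy : ∀ t ∈ Set.Icc 0 t₀, ∀ k ∈ K, HasDerivWithinAt (fun r => y r k)
      (-(ν k : ℂ) * y t k + g t k) (Set.Icc 0 t₀) t)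
    {G : ℝ → ℝ} (hG0 : ∀ t ∈ Set.Icc 0 t₀, 0 ≤ G t)
    (hG : ∀ t ∈ Set.Icc 0 t₀, ∑ k ∈ K, w k * ‖g t k‖ ^ 2 ≤ G t ^ 2) {κ η f₀ : ℝ}
    (hκ : ∀ t ∈ Set.Icc 0 t₀, 2 * (√(∑ k ∈ K, w k * ‖y t k‖ ^ 2) * G t) ≤
      (κ + 2 * ν₀) * ∑ k ∈ K, w k * ‖y t k‖ ^ 2 + η)
    (h0 : ∑ k ∈ K, w k * ‖y 0 k‖ ^ 2 ≤ f₀) :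
    ∀ t ∈ Set.Icc 0 t₀, ∑ k ∈ K, w k * ‖y t k‖ ^ 2 ≤ gronwallBound f₀ κ η t := by
  set f : ℝ → ℝ := fun t => ∑ k ∈ K, w k * ‖y t k‖ ^ 2 with hf
  have hd : ∀ t ∈ Set.Icc 0 t₀, HasDerivWithinAt f
      (∑ k ∈ K, w k * (2 * inner ℝ (y t k) (-(ν k : ℂ) * y t k + g t k))) (Set.Icc 0 t₀) t :=
    fun t ht => HasDerivWithinAt.fun_sum fun k hk => ((hy t ht k hk).norm_sq).const_mul (w k)
  have hb : ∀ t ∈ Set.Icc 0 t₀,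
      ∑ k ∈ K, w k * (2 * inner ℝ (y t k) (-(ν k : ℂ) * y t k + g t k)) ≤ κ * f t + η := by
    intro t ht
    have h1 : ∀ k ∈ K, w k * (2 * inner ℝ (y t k) (-(ν k : ℂ) * y t k + g t k)) ≤
        -(2 * ν₀) * (w k * ‖y t k‖ ^ 2) + 2 * (w k * (‖y t k‖ * ‖g t k‖)) := by
      intro k hk
      have e : -(ν k : ℂ) * y t k = (-(ν k)) • y t k := by
        rw [Complex.real_smul]; push_cast; rfl
      rw [e, inner_add_right, real_inner_smul_right, real_inner_self_eq_norm_sq]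
      have h2 := real_inner_le_norm (y t k) (g t k)
      have h3 := mul_le_mul_of_nonneg_right (hν k hk) (sq_nonneg ‖y t k‖)
      have h4 := mul_le_mul_of_nonneg_left
        (show -(ν k) * ‖y t k‖ ^ 2 + inner ℝ (y t k) (g t k) ≤
          -ν₀ * ‖y t k‖ ^ 2 + ‖y t k‖ * ‖g t k‖ by linarith) (hw k)
      linarith
    refine (Finset.sum_le_sum h1).trans ?_
    rw [Finset.sum_add_distrib, ← Finset.mul_sum, ← Finset.mul_sum]
    have h5 := sum_weight_mul_le K w (fun k => ‖y t k‖) (fun k => ‖g t k‖) hw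
      (Real.sqrt_nonneg (f t)) (hG0 t ht) (by
        rw [Real.sq_sqrt (Finset.sum_nonneg fun k _ => mul_nonneg (hw k) (sq_nonneg _))])
      (hG t ht)
    have h6 := hκ t ht
    change 2 * (√(f t) * G t) ≤ (κ + 2 * ν₀) * f t + η at h6
    change -(2 * ν₀) * f t + _ ≤ _
    linarith
  intro t ht
  have := le_gronwallBound_of_liminf_deriv_right_le (f := f) (δ := f₀) (K := κ) (ε := η)
    (fun t ht => (hd t ht).continuousWithinAt)
    (fun x hx r hr => ((hd x (Set.Ico_subset_Icc_self hx)).mono_of_mem_nhdsWithin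
      (Icc_mem_nhdsGE_of_mem hx)).liminf_right_slope_le hr) h0
    (fun x hx => hb x (Set.Ico_subset_Icc_self hx)) t ht
  simpa using this

/-! ### The normal form estimate -/

/-- The nonlinearity `b P(u,p) + i c P(u,q)` with multipliers inserted in both sums. -/
noncomputable def nlin (d p q : ℕ) (b c : ℝ) (θ : (Fin (2 * p + 1) → (Fin d → ℤ)) → ℂ)
    (φ : (Fin (2 * q + 1) → (Fin d → ℤ)) → ℂ) (u : (Fin d → ℤ) → ℂ) (k : Fin d → ℤ) : ℂ :=
  (b : ℂ) * msum d p θ u k + Complex.I * (c : ℂ) * msum d q φ u k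

lemma norm_combination_le (b c : ℝ) (z w : ℂ) :
    ‖(b : ℂ) * z + Complex.I * (c : ℂ) * w‖ ≤ |b| * ‖z‖ + |c| * ‖w‖ := by
  refine (norm_add_le _ _).trans (le_of_eq ?_)
  simp

lemma IsBd.combination {d : ℕ} {σ : ℝ} (b c : ℝ) {z w : (Fin d → ℤ) → ℂ} {Z W : ℝ}
    (hz : IsBd d σ (fun k => ‖z k‖) Z) (hw : IsBd d σ (fun k => ‖w k‖) W)
    (hZ : 0 ≤ Z) (hW : 0 ≤ W) :
    IsBd d σ (fun k => ‖(b : ℂ) * z k + Complex.I * (c : ℂ) * w k‖) (|b| * Z + |c| * W) :=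
  ((hz.const_mul |b|).add (hw.const_mul |c|) (by positivity) (by positivity)).mono
    (fun k => norm_nonneg _) (fun k => norm_combination_le b c _ _) (by positivity) le_rfl

/-- A bound for `nlin` on the ball of radius `A`. -/
noncomputable def nlinBd (p q : ℕ) (b c Cp Cq A : ℝ) : ℝ :=
  |b| * (Cp * A * (2 * A) ^ (2 * p)) + |c| * (Cq * A * (2 * A) ^ (2 * q))

lemma nlinBd_nonneg (p q : ℕ) (b c : ℝ) {Cp Cq A : ℝ} (hCp : 0 ≤ Cp) (hCq : 0 ≤ Cq) (hA : 0 ≤ A) :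
    0 ≤ nlinBd p q b c Cp Cq A := by
  unfold nlinBd; positivity

lemma isBd_nlin {d p q : ℕ} {σ Cp Cq : ℝ} (b c : ℝ) (hCp0 : 0 ≤ Cp) (hCq0 : 0 ≤ Cq)
    (hCp : SlotBound d p σ Cp) (hCq : SlotBound d q σ Cq)
    {θ : (Fin (2 * p + 1) → (Fin d → ℤ)) → ℂ} {φ : (Fin (2 * q + 1) → (Fin d → ℤ)) → ℂ}
    (hθ : ∀ κ, ‖θ κ‖ ≤ 1) (hφ : ∀ κ, ‖φ κ‖ ≤ 1) {u : (Fin d → ℤ) → ℂ} {A : ℝ} (hA : 0 ≤ A)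
    (hu : IsBd d σ (fun k => ‖u k‖) A) :
    IsBd d σ (fun k => ‖nlin d p q b c θ φ u k‖) (nlinBd p q b c Cp Cq A) :=
  IsBd.combination b c (isBd_msum hCp0 hCp hθ hA hu) (isBd_msum hCq0 hCq hφ hA hu)
    (by positivity) (by positivity)

lemma isBd_trunc {d : ℕ} {σ : ℝ} {K : Finset (Fin d → ℤ)} {z : (Fin d → ℤ) → ℂ} {B : ℝ}
    (h : ∑ k ∈ K, wt d σ k * ‖z k‖ ^ 2 ≤ B ^ 2) : IsBd d σ (fun k => ‖trunc K z k‖) B := by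
  intro J
  refine le_trans ?_ h
  have e : ∀ k, wt d σ k * ‖trunc K z k‖ ^ 2 = if k ∈ K then wt d σ k * ‖z k‖ ^ 2 else 0 := by
    intro k; unfold trunc; split_ifs <;> simp
  rw [Finset.sum_congr rfl fun k _ => e k, ← Finset.sum_filter]
  refine Finset.sum_le_sum_of_subset_of_nonneg (fun k hk => (Finset.mem_filter.1 hk).2)
    fun k _ _ => mul_nonneg (wt_pos d σ k).le (sq_nonneg _)

lemma gronwallBound_sq_mul (δ a κ η t : ℝ) (hκ : κ ≠ 0) :
    gronwallBound (δ ^ 2 * a) κ (δ ^ 2 * η) t = δ ^ 2 * gronwallBound a κ η t := by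
  rw [gronwallBound_of_K_ne_0 hκ, gronwallBound_of_K_ne_0 hκ]
  ring

lemma msum_oscMul_eq {d n : ℕ} {σ C : ℝ} (hC : SlotBound d n σ C) (ω : ℝ)
    {u : (Fin d → ℤ) → ℂ} {A : ℝ} (hA : 0 ≤ A) (hu : IsBd d σ (fun k => ‖u k‖) A) (k : Fin d → ℤ) :
    msum d n (oscMul d n ω) u k = msum d n (resMul d n) u k + msum d n (nonresMul d n ω) u k := by
  rw [msum, msum, msum, ← (summable_msum hC (norm_resMul_le d n) hA hu k).tsum_add
    (summable_msum hC (norm_nonresMul_le d n ω) hA hu k)]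
  exact tsum_congr fun κ => by rw [oscMul_eq, add_mul]

set_option maxHeartbeats 1000000 in
lemma exists_normalForm_bound {d p q : ℕ} (m : ℕ) {σ Cp Cq : ℝ} (b c : ℝ) (hCp0 : 0 ≤ Cp)
    (hCq0 : 0 ≤ Cq) (hCp : SlotBound d p σ Cp) (hCq : SlotBound d q σ Cq) (T : ℝ)
    {A : ℝ} (hA : 0 ≤ A) :
    ∃ C : ℝ, 0 < C ∧ ∀ μ ε δ t₀ : ℝ, 0 ≤ μ → 0 < ε → ε ≤ δ → t₀ ≤ T →
      ∀ (K : Finset (Fin d → ℤ)) (u u' : ℝ → (Fin d → ℤ) → ℂ),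
      (∀ t ∈ Set.Icc 0 t₀, IsBd d σ (fun k => ‖u t k‖) A) →
      (∀ t ∈ Set.Icc 0 t₀, IsBd d σ (fun k => ‖u' t k‖) A) →
      (∀ t ∈ Set.Icc 0 t₀, IsBd d σ (fun k => ‖u t k - trunc K (u t) k‖) δ) →
      (∀ t ∈ Set.Icc 0 t₀, IsBd d σ (fun k => ‖u' t k - trunc K (u' t) k‖) δ) →
      (∀ t ∈ Set.Icc 0 t₀, IsBd d σ (fun k => ε * μ * (lam d k : ℝ) ^ m * ‖trunc K (u t) k‖) δ) →
      (∀ t ∈ Set.Icc 0 t₀, ∀ k, HasDerivWithinAt (fun r => u r k)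
        (-((μ * (lam d k : ℝ) ^ m : ℝ) : ℂ) * u t k
          + nlin d p q b c (oscMul d p (t / ε)) (oscMul d q (t / ε)) (u t) k) (Set.Icc 0 t₀) t) →
      (∀ t ∈ Set.Icc 0 t₀, ∀ k, HasDerivWithinAt (fun r => u' r k)
        (-((μ * (lam d k : ℝ) ^ m : ℝ) : ℂ) * u' t k
          + nlin d p q b c (resMul d p) (resMul d q) (u' t) k) (Set.Icc 0 t₀) t) →
      u' 0 = u 0 →
      ∀ t ∈ Set.Icc 0 t₀, IsBd d σ (fun k => ‖u t k - u' t k‖) (C * δ) := by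
  set F : ℝ := nlinBd p q b c Cp Cq A with hF
  have hF0 : 0 ≤ F := nlinBd_nonneg p q b c hCp0 hCq0 hA
  set L : ℝ := |b| * (Cp * (2 * A) ^ (2 * p)) + |c| * (Cq * (2 * A) ^ (2 * q)) with hL
  have hL0 : 0 ≤ L := by positivity
  set S : ℝ := ((2 * p + 1 : ℝ) ^ 2) ^ m + ((2 * q + 1 : ℝ) ^ 2) ^ m with hS
  have hS0 : 0 ≤ S := by positivity
  set N : ℝ := L * (L * A + 4 + F + S) with hN
  have hN0 : 0 ≤ N := by positivity
  set Γ : ℝ := gronwallBound ((L * A) ^ 2) (2 * L + 1) (N ^ 2) T with hΓ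
  refine ⟨√Γ + L * A + 2, by positivity, ?_⟩
  intro μ ε δ t₀ hμ hε hεδ ht₀ K u u' hu hu' htail htail' hdamp hdu hdu' h0
  have hδ : 0 < δ := hε.trans_le hεδ
  set z : ℝ → (Fin d → ℤ) → ℂ := fun t k => (b : ℂ) * nfSum d p K (t / ε) (u t) k
    + Complex.I * (c : ℂ) * nfSum d q K (t / ε) (u t) k with hz
  set du : ℝ → (Fin d → ℤ) → ℂ := fun t k => -((μ * (lam d k : ℝ) ^ m : ℝ) : ℂ) * u t k
          + nlin d p q b c (oscMul d p (t / ε)) (oscMul d q (t / ε)) (u t) k with hdudef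
  set y : ℝ → (Fin d → ℤ) → ℂ := fun t k => u t k - u' t k - (ε : ℂ) * z t k with hy
  set g : ℝ → (Fin d → ℤ) → ℂ := fun t k =>
    (b : ℂ) * nfRem d p m K ε (t / ε) μ (u t) (u' t) (du t) k
      + Complex.I * (c : ℂ) * nfRem d q m K ε (t / ε) μ (u t) (u' t) (du t) k with hg
  set f : ℝ → ℝ := fun t => ∑ k ∈ K, wt d σ k * ‖y t k‖ ^ 2 with hf
  have hf0 : ∀ t, 0 ≤ f t := fun t =>
    Finset.sum_nonneg fun k _ => mul_nonneg (wt_pos d σ k).le (sq_nonneg _)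
  have hzb : ∀ t ∈ Set.Icc 0 t₀, IsBd d σ (fun k => ‖(ε : ℂ) * z t k‖) (L * A * δ) := by
    intro t ht
    refine ((IsBd.combination b c (isBd_nfSum hCp0 hCp K (t / ε) hA (hu t ht))
      (isBd_nfSum hCq0 hCq K (t / ε) hA (hu t ht)) (by positivity) (by positivity)).const_mul
      ε).mono (fun k => norm_nonneg _) (fun k => ?_) (by positivity) ?_
    · rw [norm_mul, Complex.norm_real, Real.norm_of_nonneg hε.le]
    · have h1 : A ^ (2 * p) ≤ (2 * A) ^ (2 * p) := pow_le_pow_left₀ hA (by linarith) _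
      have h2 : A ^ (2 * q) ≤ (2 * A) ^ (2 * q) := pow_le_pow_left₀ hA (by linarith) _
      calc ε * (|b| * (Cp * A * A ^ (2 * p)) + |c| * (Cq * A * A ^ (2 * q)))
          ≤ δ * (|b| * (Cp * A * (2 * A) ^ (2 * p)) + |c| * (Cq * A * (2 * A) ^ (2 * q))) := by
            gcongr
        _ = L * A * δ := by rw [hL]; ring
  have hW : ∀ t ∈ Set.Icc 0 t₀,
      IsBd d σ (fun k => ‖u t k - u' t k‖) (√(f t) + L * A * δ + 2 * δ) := by
    intro t ht
    have h1 : IsBd d σ (fun k => ‖trunc K (y t) k‖) (√(f t)) :=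
      isBd_trunc (by rw [Real.sq_sqrt (hf0 t)])
    refine ((h1.add (hzb t ht) (Real.sqrt_nonneg _) (by positivity)).add
      ((htail t ht).add (htail' t ht) hδ.le hδ.le) (by positivity) (by positivity)).mono
      (fun k => norm_nonneg _) (fun k => ?_) (by positivity) (by linarith)
    by_cases hk : k ∈ K
    · have e : u t k - u' t k = trunc K (y t) k + (ε : ℂ) * z t k := by
        simp [trunc, hk, hy]
      rw [e]
      exact (norm_add_le _ _).trans (le_add_of_nonneg_right (by positivity))
    · simp only [trunc, hk, if_false, sub_zero, norm_zero, zero_add]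
      exact (norm_sub_le _ _).trans (le_add_of_nonneg_left (norm_nonneg _))
  have hD : ∀ t ∈ Set.Icc 0 t₀, IsBd d σ (fun k => ‖trunc K (du t) k‖) (ε⁻¹ * δ + F) := by
    intro t ht
    refine (((hdamp t ht).const_mul ε⁻¹).add (isBd_nlin b c hCp0 hCq0 hCp hCq
      (fun κ => (norm_oscMul d p (t / ε) κ).le) (fun κ => (norm_oscMul d q (t / ε) κ).le)
      hA (hu t ht)) (by positivity) hF0).mono (fun k => norm_nonneg _) (fun k => ?_)
      (by positivity) le_rfl
    have hlk : 0 ≤ μ * (lam d k : ℝ) ^ m := by have := lam_cast_nonneg d k; positivity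
    by_cases hk : k ∈ K
    · simp only [trunc, hk, if_true, hdudef]
      refine (norm_add_le _ _).trans (add_le_add (le_of_eq ?_) le_rfl)
      rw [norm_mul, norm_neg, Complex.norm_real, Real.norm_of_nonneg hlk]
      field_simp
    · simp [trunc, hk]
  have hgb : ∀ t ∈ Set.Icc 0 t₀, IsBd d σ (fun k => ‖g t k‖) (L * √(f t) + N * δ) := by
    intro t ht
    have hW0 : 0 ≤ √(f t) + L * A * δ + 2 * δ := by positivity
    have hD0 : 0 ≤ ε⁻¹ * δ + F := by positivity
    have h := IsBd.combination b c
      (isBd_nfRem hCp0 hCp m K (t / ε) hε.le hμ hA hW0 hδ.le hD0 (hu t ht) (hu' t ht) (hW t ht)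
        (htail t ht) (hdamp t ht) (hD t ht))
      (isBd_nfRem hCq0 hCq m K (t / ε) hε.le hμ hA hW0 hδ.le hD0 (hu t ht) (hu' t ht) (hW t ht)
        (htail t ht) (hdamp t ht) (hD t ht)) (by positivity) (by positivity)
    refine h.mono (fun k => norm_nonneg _) (fun k => le_rfl) (by positivity) ?_
    have e1 : ε * (ε⁻¹ * δ + F) ≤ δ + F * δ := by
      have : ε * (ε⁻¹ * δ + F) = δ + F * ε := by field_simp
      rw [this]
      gcongr
    have e2 : ((2 * p + 1 : ℝ) ^ 2) ^ m ≤ S := le_add_of_nonneg_right (by positivity)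
    have e3 : ((2 * q + 1 : ℝ) ^ 2) ^ m ≤ S := le_add_of_nonneg_left (by positivity)
    set W : ℝ := √(f t) + L * A * δ + 2 * δ with hWdef
    calc |b| * (Cp * (2 * A) ^ (2 * p) *
            (W + δ + ε * (ε⁻¹ * δ + F) + ((2 * p + 1 : ℝ) ^ 2) ^ m * δ)) +
          |c| * (Cq * (2 * A) ^ (2 * q) *
            (W + δ + ε * (ε⁻¹ * δ + F) + ((2 * q + 1 : ℝ) ^ 2) ^ m * δ))
        ≤ |b| * (Cp * (2 * A) ^ (2 * p) * (W + δ + (δ + F * δ) + S * δ)) +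
          |c| * (Cq * (2 * A) ^ (2 * q) * (W + δ + (δ + F * δ) + S * δ)) := by gcongr
      _ = L * √(f t) + N * δ := by rw [hN, hWdef, hL]; ring
  have hyd : ∀ t ∈ Set.Icc 0 t₀, ∀ k ∈ K, HasDerivWithinAt (fun r => y r k)
      (-((μ * (lam d k : ℝ) ^ m : ℝ) : ℂ) * y t k + g t k) (Set.Icc 0 t₀) t := by
    intro t ht k _
    have h1 := hasDerivWithinAt_nfSum d p K ε u (du t) _ t (hdu t ht) k
    have h2 := hasDerivWithinAt_nfSum d q K ε u (du t) _ t (hdu t ht) k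
    refine (((hdu t ht k).sub (hdu' t ht k)).sub (((h1.const_mul (b : ℂ)).add
      (h2.const_mul (Complex.I * (c : ℂ)))).const_mul (ε : ℂ))).congr_deriv ?_
    have hε' : (ε : ℂ) ≠ 0 := by exact_mod_cast hε.ne'
    have k1 := msum_oscMul_eq hCp (t / ε) hA (hu t ht) k
    have k2 := msum_oscMul_eq hCq (t / ε) hA (hu t ht) k
    simp only [hy, hg, hz, nfRem]
    unfold nlin
    rw [k1, k2]
    push_cast
    field_simp
    ring
  have key := le_gronwallBound_of_weighted_energy K (wt d σ) (fun k => μ * (lam d k : ℝ) ^ m)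
    (fun k => (wt_pos d σ k).le) (ν₀ := 0)
    (fun k _ => by have := lam_cast_nonneg d k; positivity) hyd
    (G := fun t => L * √(f t) + N * δ) (fun t _ => by positivity)
    (fun t ht => hgb t ht K) (κ := 2 * L + 1) (η := δ ^ 2 * N ^ 2) (f₀ := δ ^ 2 * (L * A) ^ 2)
    (fun t _ => by
      change 2 * (√(f t) * (L * √(f t) + N * δ)) ≤ (2 * L + 1 + 2 * 0) * f t + δ ^ 2 * N ^ 2
      have := Real.sq_sqrt (hf0 t)
      nlinarith [sq_nonneg (√(f t) - N * δ)])
  intro t ht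
  have ht0 : (0 : ℝ) ∈ Set.Icc 0 t₀ := ⟨le_rfl, ht.1.trans ht.2⟩
  have hft : f t ≤ δ ^ 2 * Γ := by
    refine (key ?_ t ht).trans ?_
    · have := hzb 0 ht0 K
      simp only [hy, h0, sub_self, zero_sub, norm_neg]
      exact this.trans (le_of_eq (by ring))
    · rw [gronwallBound_sq_mul _ _ _ _ _ (by positivity)]
      exact mul_le_mul_of_nonneg_left (gronwallBound_mono (by positivity) (by positivity)
        (by positivity) (ht.2.trans ht₀)) (by positivity)
  refine (hW t ht).mono (fun k => norm_nonneg _) (fun k => le_rfl) (by positivity) ?_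
  have : √(f t) ≤ δ * √Γ := by
    refine (Real.sqrt_le_sqrt hft).trans (le_of_eq ?_)
    rw [Real.sqrt_mul (sq_nonneg δ), Real.sqrt_sq hδ.le]
  linarith

/-! ### The interaction representation -/

/-- The sequence with coordinates `exp(-i ω λ_k) v_k`. -/
noncomputable def interact (d : ℕ) (ω : ℝ) (v : (Fin d → ℤ) → ℂ) (k : Fin d → ℤ) : ℂ :=
  Complex.exp (-(Complex.I * (ω * (lam d k : ℂ)))) * v k

@[simp] lemma norm_interact (d : ℕ) (ω : ℝ) (v : (Fin d → ℤ) → ℂ) (k : Fin d → ℤ) :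
    ‖interact d ω v k‖ = ‖v k‖ := by
  have : -(Complex.I * (ω * (lam d k : ℂ))) = ((-(ω * lam d k) : ℝ) : ℂ) * Complex.I := by
    push_cast; ring
  rw [interact, norm_mul, this, Complex.norm_exp_ofReal_mul_I, one_mul]

@[simp] lemma interact_zero (d : ℕ) (v : (Fin d → ℤ) → ℂ) : interact d 0 v = v := by
  funext k; simp [interact]

lemma slotFactor_exp (j : ℕ) (x : ℝ) :
    slotFactor j (Complex.exp (-(Complex.I * x))) =
      Complex.exp (-(Complex.I * (((-1) ^ j * x : ℝ) : ℂ))) := by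
  unfold slotFactor
  split_ifs with h
  · simp [h.neg_one_pow]
  · rw [← Complex.exp_conj, (Nat.not_even_iff_odd.1 h).neg_one_pow]
    simp [Complex.conj_ofReal]

lemma interact_Pk (d n : ℕ) (ω : ℝ) (v : (Fin d → ℤ) → ℂ) (k : Fin d → ℤ) :
    interact d ω (Pk d n v) k = msum d n (oscMul d n ω) (interact d ω v) k := by
  rw [interact, Pk, msum, ← tsum_mul_left]
  refine tsum_congr fun κ => ?_
  rw [Pterm_eq, Pterm_eq]
  split_ifs with hk
  · have h1 : ∀ j : Fin (2 * n + 1), slotFactor j (interact d ω v (κ j)) =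
        Complex.exp (-(Complex.I * (((-1) ^ (j : ℕ) * (ω * lam d (κ j)) : ℝ) : ℂ)))
          * slotFactor j (v (κ j)) := by
      intro j
      rw [interact, slotFactor_mul, ← slotFactor_exp]
      push_cast
      rfl
    rw [Finset.prod_congr rfl fun j _ => h1 j, Finset.prod_mul_distrib, ← Complex.exp_sum,
      oscMul, ← mul_assoc (Complex.exp (Complex.I * _)), ← Complex.exp_add]
    congr 2
    rw [defect, hk]
    push_cast
    rw [Finset.sum_neg_distrib, ← Finset.mul_sum]
    have e : ∑ j : Fin (2 * n + 1), (-1 : ℂ) ^ (j : ℕ) * ((ω : ℂ) * (lam d (κ j) : ℂ)) =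
        ω * ∑ j : Fin (2 * n + 1), (-1 : ℂ) ^ (j : ℕ) * (lam d (κ j) : ℂ) := by
      rw [Finset.mul_sum]; exact Finset.sum_congr rfl fun j _ => by ring
    rw [e]
    ring
  · simp

lemma hasDerivWithinAt_interact {d m p q : ℕ} {ε μ b c : ℝ}
    {v : ℝ → (Fin d → ℤ) → ℂ} {s : Set ℝ} {t : ℝ} {k : Fin d → ℤ}
    (h : HasDerivWithinAt (fun t => v t k)
      (((ε : ℂ))⁻¹ * Complex.I * (lam d k : ℂ) * v t k - (μ : ℂ) * (lam d k : ℂ) ^ m * v t k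
        + (b : ℂ) * Pk d p (v t) k + Complex.I * (c : ℂ) * Pk d q (v t) k) s t) :
    HasDerivWithinAt (fun r => interact d (r / ε) (v r) k)
      (-((μ * (lam d k : ℝ) ^ m : ℝ) : ℂ) * interact d (t / ε) (v t) k
        + nlin d p q b c (oscMul d p (t / ε)) (oscMul d q (t / ε)) (interact d (t / ε) (v t)) k)
      s t := by
  have h1 : HasDerivAt (fun r : ℝ => -(Complex.I * (((r / ε : ℝ) : ℂ) * (lam d k : ℂ))))
      (-(Complex.I * ((ε : ℂ)⁻¹ * (lam d k : ℂ)))) t := by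
    have h0 : HasDerivAt (fun r : ℝ => (((r / ε : ℝ)) : ℂ)) ((ε : ℂ)⁻¹) t := by
      have := ((hasDerivAt_id t).div_const ε).ofReal_comp
      simpa using this
    exact ((h0.mul_const _).const_mul _).neg
  refine (h1.cexp.hasDerivWithinAt.mul h).congr_deriv ?_
  rw [nlin, ← interact_Pk, ← interact_Pk]
  simp only [interact]
  push_cast
  ring

/-! ### Frequency cut-offs -/

lemma finite_lam_le (d : ℕ) (Λ : ℝ) : {k : Fin d → ℤ | (lam d k : ℝ) ≤ Λ}.Finite := by
  refine (Set.Finite.pi' (t := fun _ => Set.Icc (-⌈Λ⌉) ⌈Λ⌉)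
    fun _ => Set.finite_Icc _ _).subset fun k hk i => ?_
  have h1 : (k i) ^ 2 ≤ lam d k :=
    Finset.single_le_sum (f := fun i => (k i) ^ 2) (fun i _ => sq_nonneg _) (Finset.mem_univ i)
  have h2 : lam d k ≤ ⌈Λ⌉ := by
    have : (lam d k : ℝ) ≤ (⌈Λ⌉ : ℤ) := le_trans hk (Int.le_ceil Λ)
    exact_mod_cast this
  have h3 : |k i| ≤ (k i) ^ 2 := by
    rw [← sq_abs]; exact Int.le_self_sq _
  rw [Set.mem_Icc]
  exact abs_le.1 (h3.trans (h1.trans h2))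

/-- The finite set of frequencies with `|k|² ≤ Λ`. -/
noncomputable def lowFreq (d : ℕ) (Λ : ℝ) : Finset (Fin d → ℤ) := (finite_lam_le d Λ).toFinset

lemma mem_lowFreq {d : ℕ} {Λ : ℝ} {k : Fin d → ℤ} : k ∈ lowFreq d Λ ↔ (lam d k : ℝ) ≤ Λ := by
  simp [lowFreq]

lemma lam_eq_zero_or_one_le (d : ℕ) (k : Fin d → ℤ) :
    (lam d k : ℝ) = 0 ∨ 1 ≤ (lam d k : ℝ) := by
  rcases (lam_nonneg d k).eq_or_lt with h | h
  · left; exact_mod_cast h.symm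
  · right; exact_mod_cast h

lemma wt_mono (d : ℕ) {σ s : ℝ} (hσ : 0 < σ) (hσs : σ ≤ s) (k : Fin d → ℤ) :
    wt d σ k ≤ wt d s k := by
  unfold wt
  rcases lam_eq_zero_or_one_le d k with h | h
  · rw [h, Real.zero_rpow hσ.ne', Real.zero_rpow (hσ.trans_le hσs).ne']
  · gcongr

lemma IsBd.of_le_wt {d : ℕ} {σ s : ℝ} {x y : (Fin d → ℤ) → ℝ} {A c : ℝ} (hx : IsBd d s x A)
    (h : ∀ k, wt d σ k * y k ^ 2 ≤ c ^ 2 * (wt d s k * x k ^ 2)) : IsBd d σ y (c * A) := by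
  intro K
  calc ∑ k ∈ K, wt d σ k * y k ^ 2 ≤ ∑ k ∈ K, c ^ 2 * (wt d s k * x k ^ 2) :=
        Finset.sum_le_sum fun k _ => h k
    _ = c ^ 2 * ∑ k ∈ K, wt d s k * x k ^ 2 := by rw [Finset.mul_sum]
    _ ≤ c ^ 2 * A ^ 2 := mul_le_mul_of_nonneg_left (hx K) (sq_nonneg _)
    _ = (c * A) ^ 2 := by ring

lemma IsBd.mono_exponent {d : ℕ} {σ s : ℝ} {x : (Fin d → ℤ) → ℝ} {A : ℝ} (hσ : 0 < σ)
    (hσs : σ ≤ s) (hx : IsBd d s x A) : IsBd d σ x A := by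
  have := hx.of_le_wt (σ := σ) (y := x) (c := 1) fun k => by
    rw [one_pow, one_mul]
    exact mul_le_mul_of_nonneg_right (wt_mono d hσ hσs k) (sq_nonneg _)
  simpa using this

lemma wt_le_of_lt_lam {d : ℕ} {σ s Λ : ℝ} (hσ : 0 < σ) (hσs : σ ≤ s) (hΛ : 1 ≤ Λ) {k : Fin d → ℤ}
    (hk : Λ < lam d k) : wt d σ k ≤ 2 * Λ ^ (-(s - σ)) * wt d s k := by
  have h1 : (1 : ℝ) ≤ lam d k := hΛ.trans hk.le
  have h0 : (0 : ℝ) < lam d k := by linarith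
  have h2 : (lam d k : ℝ) ^ σ = (lam d k : ℝ) ^ (-(s - σ)) * (lam d k : ℝ) ^ s := by
    rw [← Real.rpow_add h0]; congr 1; ring
  have h3 : (lam d k : ℝ) ^ (-(s - σ)) ≤ Λ ^ (-(s - σ)) :=
    Real.rpow_le_rpow_of_nonpos (by linarith) hk.le (by linarith)
  have h4 : 1 ≤ (lam d k : ℝ) ^ σ := Real.one_le_rpow h1 hσ.le
  have h5 : (0 : ℝ) ≤ Λ ^ (-(s - σ)) := by positivity
  have h6 : (0 : ℝ) ≤ (lam d k : ℝ) ^ s := by positivity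
  calc wt d σ k ≤ 2 * (lam d k : ℝ) ^ σ := by unfold wt; linarith
    _ ≤ 2 * (Λ ^ (-(s - σ)) * (lam d k : ℝ) ^ s) := by
        rw [h2]; gcongr
    _ ≤ 2 * Λ ^ (-(s - σ)) * wt d s k := by
        unfold wt; nlinarith

lemma isBd_sub_trunc_lowFreq {d : ℕ} {σ s Λ : ℝ} (hσ : 0 < σ) (hσs : σ ≤ s) (hΛ : 1 ≤ Λ)
    {u : (Fin d → ℤ) → ℂ} {A : ℝ} (hu : IsBd d s (fun k => ‖u k‖) A) :
    IsBd d σ (fun k => ‖u k - trunc (lowFreq d Λ) u k‖) (2 * Λ ^ (-(s - σ) / 2) * A) := by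
  have h5 : (0 : ℝ) ≤ Λ ^ (-(s - σ)) := by positivity
  refine hu.of_le_wt fun k => ?_
  have e : (2 * Λ ^ (-(s - σ) / 2)) ^ 2 = 4 * Λ ^ (-(s - σ)) := by
    rw [mul_pow, ← Real.rpow_natCast, ← Real.rpow_natCast, ← Real.rpow_mul (by linarith)]
    norm_num
  rw [e]
  have hw := wt_pos d s k
  by_cases hk : k ∈ lowFreq d Λ
  · simp only [trunc, hk, if_true, sub_self, norm_zero]
    rw [zero_pow two_ne_zero, mul_zero]
    positivity
  · simp only [trunc, hk, if_false, sub_zero]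
    rw [mem_lowFreq, not_le] at hk
    rw [← mul_assoc]
    refine mul_le_mul_of_nonneg_right ?_ (sq_nonneg _)
    refine (wt_le_of_lt_lam hσ hσs hΛ hk).trans ?_
    gcongr
    norm_num

lemma isBd_damped_trunc_lowFreq {d m : ℕ} {σ s Λ : ℝ} (ν : ℝ) (hσ : 0 < σ)
    (hsm : s - σ ≤ m) (hm : 1 ≤ m) (hΛ : 1 ≤ Λ)
    {u : (Fin d → ℤ) → ℂ} {A : ℝ} (hu : IsBd d s (fun k => ‖u k‖) A) :
    IsBd d σ (fun k => ν * (lam d k : ℝ) ^ m * ‖trunc (lowFreq d Λ) u k‖)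
      (2 * ν * Λ ^ (m - (s - σ) / 2) * A) := by
  have hΛ0 : 0 < Λ := by linarith
  refine hu.of_le_wt fun k => ?_
  have e : (2 * ν * Λ ^ (m - (s - σ) / 2)) ^ 2 = 4 * ν ^ 2 * Λ ^ (2 * m - (s - σ)) := by
    rw [mul_pow, ← Real.rpow_natCast (Λ ^ _), ← Real.rpow_mul hΛ0.le]
    push_cast
    rw [show ((m : ℝ) - (s - σ) / 2) * 2 = 2 * m - (s - σ) by ring]
    ring
  rw [e]
  have hw := wt_pos d s k
  by_cases hk : k ∈ lowFreq d Λ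
  · simp only [trunc, hk, if_true]
    rw [mem_lowFreq] at hk
    rcases lam_eq_zero_or_one_le d k with h | h
    · rw [h, zero_pow (by omega)]
      simp only [mul_zero, zero_mul, ne_eq, OfNat.ofNat_ne_zero, not_false_eq_true, zero_pow]
      positivity
    · have h0 : (0 : ℝ) < lam d k := by linarith
      have hm1 : (1 : ℝ) ≤ m := by exact_mod_cast hm
      have e2 : (lam d k : ℝ) ^ σ * ((lam d k : ℝ) ^ m) ^ 2
          = (lam d k : ℝ) ^ (2 * m - (s - σ)) * (lam d k : ℝ) ^ s := by
        rw [← Real.rpow_natCast (lam d k : ℝ) m, ← Real.rpow_natCast _ 2, ← Real.rpow_mul h0.le,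
          ← Real.rpow_add h0, ← Real.rpow_add h0]
        congr 1; push_cast; ring
      have h3 : (lam d k : ℝ) ^ (2 * m - (s - σ)) ≤ Λ ^ (2 * m - (s - σ)) :=
        Real.rpow_le_rpow h0.le hk (by linarith)
      have h4 : 1 ≤ (lam d k : ℝ) ^ σ := Real.one_le_rpow h hσ.le
      have h6 : (0 : ℝ) ≤ (lam d k : ℝ) ^ s := by positivity
      have h7 : wt d σ k * ((lam d k : ℝ) ^ m) ^ 2 ≤ 4 * Λ ^ (2 * m - (s - σ)) * wt d s k := by
        have h8 : (0 : ℝ) ≤ Λ ^ (2 * m - (s - σ)) := by positivity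
        calc wt d σ k * ((lam d k : ℝ) ^ m) ^ 2
            ≤ 2 * (lam d k : ℝ) ^ σ * ((lam d k : ℝ) ^ m) ^ 2 := by
              refine mul_le_mul_of_nonneg_right ?_ (sq_nonneg _)
              unfold wt; linarith
          _ = 2 * ((lam d k : ℝ) ^ (2 * m - (s - σ)) * (lam d k : ℝ) ^ s) := by
              rw [← e2]; ring
          _ ≤ 2 * (Λ ^ (2 * m - (s - σ)) * (lam d k : ℝ) ^ s) := by gcongr
          _ ≤ _ := by unfold wt; nlinarith [mul_nonneg h8 h6]
      calc wt d σ k * (ν * (lam d k : ℝ) ^ m * ‖u k‖) ^ 2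
          = ν ^ 2 * ‖u k‖ ^ 2 * (wt d σ k * ((lam d k : ℝ) ^ m) ^ 2) := by ring
        _ ≤ ν ^ 2 * ‖u k‖ ^ 2 * (4 * Λ ^ (2 * m - (s - σ)) * wt d s k) := by gcongr
        _ = _ := by ring
  · simp only [trunc, hk, if_false, norm_zero, mul_zero]
    rw [zero_pow two_ne_zero, mul_zero]
    positivity

/-! ### Comparison of the two flows -/

/-- `u` solves the damped system on `[0,T]` with the multipliers `θ`, `φ` in the nonlinearity. -/
def SolvesDamped (d m p q : ℕ) (μ b c T : ℝ) (θ : ℝ → (Fin (2 * p + 1) → (Fin d → ℤ)) → ℂ)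
    (φ : ℝ → (Fin (2 * q + 1) → (Fin d → ℤ)) → ℂ) (u : ℝ → (Fin d → ℤ) → ℂ) : Prop :=
  ∀ t ∈ Set.Icc 0 T, ∀ k, HasDerivWithinAt (fun r => u r k)
    (-((μ * (lam d k : ℝ) ^ m : ℝ) : ℂ) * u t k + nlin d p q b c (θ t) (φ t) (u t) k)
    (Set.Icc 0 T) t

lemma SolvesDamped.mono {d m p q : ℕ} {μ b c T t₀ : ℝ}
    {θ : ℝ → (Fin (2 * p + 1) → (Fin d → ℤ)) → ℂ} {φ : ℝ → (Fin (2 * q + 1) → (Fin d → ℤ)) → ℂ}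
    {u : ℝ → (Fin d → ℤ) → ℂ} (h : SolvesDamped d m p q μ b c T θ φ u) (ht₀ : t₀ ≤ T) :
    SolvesDamped d m p q μ b c t₀ θ φ u := fun t ht k =>
  (h t (Set.Icc_subset_Icc_right ht₀ ht) k).mono (Set.Icc_subset_Icc_right ht₀)

lemma sum_highFreq_le {d m p q : ℕ} {σ Cp Cq : ℝ} {b c : ℝ} (hCp0 : 0 ≤ Cp)
    (hCq0 : 0 ≤ Cq) (hCp : SlotBound d p σ Cp) (hCq : SlotBound d q σ Cq) {A μ t₀ Λ : ℝ}
    (hA : 0 ≤ A) (hμ : 0 < μ) (hΛ : 0 < Λ)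
    {θ θ' : ℝ → (Fin (2 * p + 1) → (Fin d → ℤ)) → ℂ}
    {φ φ' : ℝ → (Fin (2 * q + 1) → (Fin d → ℤ)) → ℂ} {u u' : ℝ → (Fin d → ℤ) → ℂ}
    (hθ : ∀ t κ, ‖θ t κ‖ ≤ 1) (hφ : ∀ t κ, ‖φ t κ‖ ≤ 1)
    (hθ' : ∀ t κ, ‖θ' t κ‖ ≤ 1) (hφ' : ∀ t κ, ‖φ' t κ‖ ≤ 1)
    (hu : ∀ t ∈ Set.Icc 0 t₀, IsBd d σ (fun k => ‖u t k‖) A)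
    (hu' : ∀ t ∈ Set.Icc 0 t₀, IsBd d σ (fun k => ‖u' t k‖) A)
    (hdu : SolvesDamped d m p q μ b c t₀ θ φ u) (hdu' : SolvesDamped d m p q μ b c t₀ θ' φ' u')
    (h0 : u' 0 = u 0) (K : Finset (Fin d → ℤ)) (hK : ∀ k ∈ K, Λ ≤ (lam d k : ℝ)) :
    ∀ t ∈ Set.Icc 0 t₀, ∑ k ∈ K, wt d σ k * ‖u t k - u' t k‖ ^ 2 ≤
      (2 * nlinBd p q b c Cp Cq A / (μ * Λ ^ m)) ^ 2 := by
  set F : ℝ := nlinBd p q b c Cp Cq A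
  have hF0 : 0 ≤ F := nlinBd_nonneg p q b c hCp0 hCq0 hA
  set N : ℝ := μ * Λ ^ m
  have hN : 0 < N := by positivity
  set g : ℝ → (Fin d → ℤ) → ℂ := fun t k =>
    nlin d p q b c (θ t) (φ t) (u t) k - nlin d p q b c (θ' t) (φ' t) (u' t) k with hg
  have key := le_gronwallBound_of_weighted_energy K (wt d σ) (fun k => μ * (lam d k : ℝ) ^ m)
    (fun k => (wt_pos d σ k).le) (ν₀ := N) (t₀ := t₀) (y := fun t k => u t k - u' t k) (g := g)
    (fun k hk => mul_le_mul_of_nonneg_left (pow_le_pow_left₀ hΛ.le (hK k hk) m) hμ.le)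
    (fun t ht k _ => ((hdu t ht k).sub (hdu' t ht k)).congr_deriv (by simp only [hg]; ring))
    (G := fun _ => 2 * F) (fun t _ => by positivity)
    (fun t ht => by
      have h1 := isBd_nlin b c hCp0 hCq0 hCp hCq (hθ t) (hφ t) hA (hu t ht)
      have h2 := isBd_nlin b c hCp0 hCq0 hCp hCq (hθ' t) (hφ' t) hA (hu' t ht)
      exact (h1.add h2 hF0 hF0).mono (fun k => norm_nonneg _) (fun k => norm_sub_le _ _)
        (by positivity) (two_mul F).ge K)
    (κ := -N) (η := 4 * F ^ 2 / N) (f₀ := 0)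
    (fun t _ => by
      set f : ℝ := ∑ k ∈ K, wt d σ k * ‖u t k - u' t k‖ ^ 2
      have hf0 : 0 ≤ f := Finset.sum_nonneg fun k _ =>
        mul_nonneg (wt_pos d σ k).le (sq_nonneg _)
      have h1 := Real.sq_sqrt hf0
      have h2 : N * f + 4 * F ^ 2 / N - 2 * (√f * (2 * F)) = (N * √f - 2 * F) ^ 2 / N := by
        field_simp; linear_combination -(N ^ 2) * h1
      have h3 : 0 ≤ (N * √f - 2 * F) ^ 2 / N := by positivity
      linarith)
    (by simp [h0])
  intro t ht
  refine (key t ht).trans ?_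
  rw [gronwallBound_of_K_ne_0 (by linarith)]
  beta_reduce
  have e : 0 * Real.exp (-N * t) + 4 * F ^ 2 / N / -N * (Real.exp (-N * t) - 1) =
      (2 * F / N) ^ 2 - (2 * F / N) ^ 2 * Real.exp (-N * t) := by
    field_simp; ring
  rw [e]
  have : 0 ≤ (2 * F / N) ^ 2 * Real.exp (-N * t) := by positivity
  linarith

lemma exists_isBd_sub_rpow {d m p q : ℕ} (hd : 1 ≤ d) (hm : 1 ≤ m) {σ s μ T : ℝ} (b c : ℝ)
    (hμ : 0 ≤ μ) (hσ : (d : ℝ) / 2 < σ) (hσs : σ < s) (hsm : s - σ ≤ m) {A : ℝ} (hA : 1 ≤ A) :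
    ∃ C : ℝ, 0 < C ∧ ∀ ε t₀ : ℝ, 0 < ε → ε ≤ 1 → t₀ ≤ T → ∀ u u' : ℝ → (Fin d → ℤ) → ℂ,
      (∀ t ∈ Set.Icc 0 t₀, IsBd d s (fun k => ‖u t k‖) A) →
      (∀ t ∈ Set.Icc 0 t₀, IsBd d s (fun k => ‖u' t k‖) A) →
      SolvesDamped d m p q μ b c t₀ (fun t => oscMul d p (t / ε)) (fun t => oscMul d q (t / ε)) u →
      SolvesDamped d m p q μ b c t₀ (fun _ => resMul d p) (fun _ => resMul d q) u' →
      u' 0 = u 0 →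
      ∀ t ∈ Set.Icc 0 t₀, IsBd d σ (fun k => ‖u t k - u' t k‖) (C * ε ^ ((s - σ) / (2 * m))) := by
  obtain ⟨Cp, hCp1, hCp⟩ := exists_slotBound d p hd σ hσ
  obtain ⟨Cq, hCq1, hCq⟩ := exists_slotBound d q hd σ hσ
  have hσ0 : 0 < σ := lt_of_le_of_lt (by positivity) hσ
  have hA0 : 0 ≤ A := by linarith
  have hm1 : (1 : ℝ) ≤ m := by exact_mod_cast hm
  have hm0 : (0 : ℝ) < m := by linarith
  obtain ⟨C, hC0, hC⟩ := exists_normalForm_bound m b c (by linarith) (by linarith) hCp hCq T hA0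
  refine ⟨C * ((2 + 2 * μ) * A), by positivity, ?_⟩
  intro ε t₀ hε hε1 ht₀ u u' hu hu' hdu hdu' h0
  set θ : ℝ := (s - σ) / (2 * m) with hθ
  have hθ1 : θ ≤ 1 := by
    rw [hθ, div_le_one (by positivity)]; linarith
  set Λ : ℝ := ε ^ (-1 / (m : ℝ)) with hΛ
  have hΛ1 : 1 ≤ Λ := Real.one_le_rpow_of_pos_of_le_one_of_nonpos hε hε1
    (div_nonpos_of_nonpos_of_nonneg (by norm_num) hm0.le)
  have e1 : Λ ^ (-(s - σ) / 2) = ε ^ θ := by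
    rw [hΛ, ← Real.rpow_mul hε.le, hθ]; congr 1; field_simp
  have e2 : ε * Λ ^ (m - (s - σ) / 2) = ε ^ θ := by
    rw [hΛ, ← Real.rpow_mul hε.le]
    nth_rw 1 [← Real.rpow_one ε]
    rw [← Real.rpow_add hε, hθ]
    congr 1; field_simp; ring
  have hεθ : ε ≤ ε ^ θ := by
    simpa using Real.rpow_le_rpow_of_exponent_ge hε hε1 hθ1
  have hεθ0 : 0 < ε ^ θ := hε.trans_le hεθ
  set δ : ℝ := (2 + 2 * μ) * A * ε ^ θ with hδ
  have hδ0 : 0 ≤ δ := by positivity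
  have htail : ∀ w : (Fin d → ℤ) → ℂ, IsBd d s (fun k => ‖w k‖) A →
      IsBd d σ (fun k => ‖w k - trunc (lowFreq d Λ) w k‖) δ := fun w hw =>
    (isBd_sub_trunc_lowFreq hσ0 hσs.le hΛ1 hw).mono (fun k => norm_nonneg _) (fun k => le_rfl)
      (by positivity) (by rw [e1, hδ]; nlinarith [mul_nonneg (mul_nonneg hμ hA0) hεθ0.le])
  have hsub := hC μ ε δ t₀ hμ hε (by
      refine hεθ.trans ?_
      rw [hδ]
      nlinarith [mul_nonneg (mul_nonneg hμ hA0) hεθ0.le, mul_nonneg (sub_nonneg.2 hA) hεθ0.le]) ht₀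
    (lowFreq d Λ) u u'
    (fun t ht => (hu t ht).mono_exponent hσ0 hσs.le)
    (fun t ht => (hu' t ht).mono_exponent hσ0 hσs.le)
    (fun t ht => htail _ (hu t ht)) (fun t ht => htail _ (hu' t ht))
    (fun t ht => (isBd_damped_trunc_lowFreq (ε * μ) hσ0 hsm hm hΛ1 (hu t ht)).mono
      (fun k => by have := lam_cast_nonneg d k; positivity) (fun k => le_rfl) (by positivity) (by
        have : 2 * (ε * μ) * Λ ^ (m - (s - σ) / 2) * A =
            2 * μ * A * (ε * Λ ^ (m - (s - σ) / 2)) := by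
          ring
        rw [this, e2, hδ]; nlinarith [mul_nonneg hA0 hεθ0.le]))
    hdu hdu' h0
  intro t ht
  have := hsub t ht
  rwa [hδ, ← mul_assoc] at this

lemma exists_isBd_sub_of_pos {d m p q : ℕ} (hd : 1 ≤ d) (hm : 1 ≤ m) {σ s μ T : ℝ} (b c : ℝ)
    (hμ : 0 < μ) (hσ : (d : ℝ) / 2 < σ) (hσs : σ < s) (hsm : s - σ ≤ m) {A : ℝ} (hA : 1 ≤ A) :
    ∃ ε₀ : ℝ, 0 < ε₀ ∧ ∀ ε t₀ : ℝ, 0 < ε → ε < ε₀ → t₀ ≤ T → ∀ u u' : ℝ → (Fin d → ℤ) → ℂ,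
      (∀ t ∈ Set.Icc 0 t₀, IsBd d s (fun k => ‖u t k‖) A) →
      (∀ t ∈ Set.Icc 0 t₀, IsBd d s (fun k => ‖u' t k‖) A) →
      SolvesDamped d m p q μ b c t₀ (fun t => oscMul d p (t / ε)) (fun t => oscMul d q (t / ε)) u →
      SolvesDamped d m p q μ b c t₀ (fun _ => resMul d p) (fun _ => resMul d q) u' →
      u' 0 = u 0 →
      ∀ t ∈ Set.Icc 0 t₀, IsBd d s (fun k => ‖u t k - u' t k‖) (3 / 4) := by
  obtain ⟨C, hC0, hC⟩ := exists_isBd_sub_rpow (p := p) (q := q) (T := T) hd hm b c hμ.le hσ hσs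
    hsm hA
  obtain ⟨Cp, hCp1, hCp⟩ := exists_slotBound d p hd s (hσ.trans hσs)
  obtain ⟨Cq, hCq1, hCq⟩ := exists_slotBound d q hd s (hσ.trans hσs)
  have hA0 : 0 ≤ A := by linarith
  have hσ0 : 0 < σ := lt_of_le_of_lt (by positivity) hσ
  have hm0 : (0 : ℝ) < m := by exact_mod_cast hm
  set F : ℝ := nlinBd p q b c Cp Cq A
  have hF0 : 0 ≤ F := nlinBd_nonneg p q b c (by linarith) (by linarith) hA0
  set Λ : ℝ := max 1 (8 * F / μ)
  have hΛ1 : 1 ≤ Λ := le_max_left _ _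
  have hΛ0 : 0 < Λ := by linarith
  have hF : 2 * F / (μ * Λ ^ m) ≤ 1 / 4 := by
    have h1 : 8 * F / μ ≤ Λ ^ m :=
      (le_max_right _ _).trans (le_self_pow₀ hΛ1 (by omega))
    rw [div_le_iff₀ hμ] at h1
    rw [div_le_iff₀ (by positivity)]
    linarith
  set B : ℝ := √(Λ ^ s + 1) with hB
  have hθ : 0 < (s - σ) / (2 * m) := div_pos (by linarith) (by positivity)
  have hlim : Filter.Tendsto (fun ε : ℝ => B * (C * ε ^ ((s - σ) / (2 * m))))
      (nhds 0) (nhds 0) := by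
    have h1 : ContinuousAt (fun ε : ℝ => B * (C * ε ^ ((s - σ) / (2 * m)))) 0 :=
      ((Real.continuousAt_rpow_const 0 _ (Or.inr hθ.le)).const_mul C).const_mul B
    have h2 := h1.tendsto
    simpa [Real.zero_rpow hθ.ne'] using h2
  obtain ⟨ε₁, hε₁, hlim⟩ := Metric.eventually_nhds_iff.1
    (hlim.eventually (eventually_le_nhds (show (0 : ℝ) < 1 / 2 by norm_num)))
  refine ⟨min ε₁ 1, lt_min hε₁ one_pos, ?_⟩
  intro ε t₀ hε hεε ht₀ u u' hu hu' hdu hdu' h0 t ht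
  have hsmall : B * (C * ε ^ ((s - σ) / (2 * m))) ≤ 1 / 2 := hlim (by
    rw [Real.dist_eq, sub_zero, abs_of_pos hε]; exact hεε.trans_le (min_le_left _ _))
  have hlow := hC ε t₀ hε (hεε.le.trans (min_le_right _ _)) ht₀ u u' hu hu' hdu hdu' h0 t ht
  have hlow' : IsBd d s (fun k => ‖trunc (lowFreq d Λ) (fun k => u t k - u' t k) k‖)
      (B * (C * ε ^ ((s - σ) / (2 * m)))) := by
    refine hlow.of_le_wt fun k => ?_
    rw [hB, Real.sq_sqrt (by positivity), ← mul_assoc]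
    have h1 := wt_pos d σ k
    by_cases hk : k ∈ lowFreq d Λ
    · simp only [trunc, hk, if_true]
      refine mul_le_mul_of_nonneg_right ?_ (sq_nonneg _)
      rw [mem_lowFreq] at hk
      have h2 := Real.rpow_le_rpow (lam_cast_nonneg d k) hk (hσ0.trans hσs).le
      have h3 : wt d s k ≤ Λ ^ s + 1 := by unfold wt; linarith
      exact h3.trans (le_mul_of_one_le_right (by positivity) (one_le_wt d σ k))
    · simp only [trunc, hk, if_false, norm_zero]
      rw [zero_pow two_ne_zero, mul_zero]
      positivity
  have hhigh : IsBd d s (fun k => ‖(u t k - u' t k) -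
      trunc (lowFreq d Λ) (fun k => u t k - u' t k) k‖) (2 * F / (μ * Λ ^ m)) := by
    intro J
    refine le_trans ?_ (sum_highFreq_le (by linarith) (by linarith) hCp hCq hA0 hμ hΛ0
      (fun t κ => (norm_oscMul d p (t / ε) κ).le) (fun t κ => (norm_oscMul d q (t / ε) κ).le)
      (fun t => norm_resMul_le d p) (fun t => norm_resMul_le d q) hu hu' hdu hdu' h0
      (J.filter fun k => k ∉ lowFreq d Λ)
      (fun k hk => by
        have := (Finset.mem_filter.1 hk).2
        rw [mem_lowFreq, not_le] at this
        exact this.le) t ht)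
    rw [Finset.sum_filter]
    refine Finset.sum_le_sum fun k _ => ?_
    by_cases hk : k ∈ lowFreq d Λ <;> simp [trunc, hk]
  refine (hlow'.add hhigh (by positivity) (by positivity)).mono (fun k => norm_nonneg _)
    (fun k => ?_) (by positivity) (by linarith)
  by_cases hk : k ∈ lowFreq d Λ <;> simp [trunc, hk]

lemma exists_isBd_sub_of_zero {d m p q : ℕ} (hd : 1 ≤ d) {s T : ℝ} (b c : ℝ)
    (hs : (d : ℝ) / 2 < s) {A : ℝ} (hA : 0 ≤ A) :
    ∃ ε₀ : ℝ, 0 < ε₀ ∧ ∀ ε t₀ : ℝ, 0 < ε → ε < ε₀ → t₀ ≤ T → ∀ u u' : ℝ → (Fin d → ℤ) → ℂ,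
      (∀ δ > 0, ∃ K, ∀ t ∈ Set.Icc 0 t₀, IsBd d s (fun k => ‖u t k - trunc K (u t) k‖) δ ∧
        IsBd d s (fun k => ‖u' t k - trunc K (u' t) k‖) δ) →
      (∀ t ∈ Set.Icc 0 t₀, IsBd d s (fun k => ‖u t k‖) A) →
      (∀ t ∈ Set.Icc 0 t₀, IsBd d s (fun k => ‖u' t k‖) A) →
      SolvesDamped d m p q 0 b c t₀ (fun t => oscMul d p (t / ε)) (fun t => oscMul d q (t / ε)) u →
      SolvesDamped d m p q 0 b c t₀ (fun _ => resMul d p) (fun _ => resMul d q) u' →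
      u' 0 = u 0 →
      ∀ t ∈ Set.Icc 0 t₀, IsBd d s (fun k => ‖u t k - u' t k‖) (3 / 4) := by
  obtain ⟨Cp, hCp1, hCp⟩ := exists_slotBound d p hd s hs
  obtain ⟨Cq, hCq1, hCq⟩ := exists_slotBound d q hd s hs
  obtain ⟨C, hC0, hC⟩ := exists_normalForm_bound m b c (by linarith) (by linarith) hCp hCq T hA
  refine ⟨3 / 4 / C, by positivity, ?_⟩
  intro ε t₀ hε hεε ht₀ u u' htail hu hu' hdu hdu' h0 t ht
  obtain ⟨K, hK⟩ := htail ε hε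
  rw [lt_div_iff₀ hC0] at hεε
  exact (hC 0 ε ε t₀ le_rfl hε le_rfl ht₀ K u u' hu hu' (fun t ht => (hK t ht).1)
    (fun t ht => (hK t ht).2)
    (fun t _ => IsBd.zero.mono (fun k => by simp) (fun k => by simp) le_rfl hε.le)
    hdu hdu' h0 t ht).mono (fun k => norm_nonneg _) (fun k => le_rfl) (by positivity) (by linarith)

/-! ### Continuity in `h^s` and conclusion -/

lemma isBd_sub_of_memH {d : ℕ} {s : ℝ} {v w : (Fin d → ℤ) → ℂ} (hv : memH d s v)
    (hw : memH d s w) : IsBd d s (fun k => ‖v k - w k‖) (hnorm d s (fun k => v k - w k)) := by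
  have h : IsBd d s (fun k => ‖v k - w k‖) (hnorm d s v + hnorm d s w) :=
    (hv.isBd.add hw.isBd (hnorm_nonneg d s v) (hnorm_nonneg d s w)).mono
      (fun k => norm_nonneg _) (fun k => norm_sub_le _ _)
      (add_nonneg (hnorm_nonneg d s v) (hnorm_nonneg d s w)) le_rfl
  have h' : memH d s (fun k => v k - w k) := h.summable
  exact h'.isBd

lemma hnorm_le_of_isBd_sub {d : ℕ} {s : ℝ} {v w : (Fin d → ℤ) → ℂ} {B : ℝ} (hB : 0 ≤ B)
    (hv : memH d s v) (h : IsBd d s (fun k => ‖v k - w k‖) B) :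
    hnorm d s w ≤ hnorm d s v + B := by
  refine IsBd.hnorm_le ?_ (add_nonneg (hnorm_nonneg d s v) hB)
  refine (hv.isBd.add h (hnorm_nonneg d s v) hB).mono (fun k => norm_nonneg _) (fun k => ?_)
    (add_nonneg (hnorm_nonneg d s v) hB) le_rfl
  have : w k = v k - (v k - w k) := by ring
  rw [this]
  refine (norm_sub_le _ _).trans (le_of_eq ?_)
  rw [← this]

lemma hContOn.continuousOn_hnorm {d : ℕ} {s T : ℝ} {v : ℝ → (Fin d → ℤ) → ℂ}
    (hv : ∀ t ∈ Set.Icc 0 T, memH d s (v t)) (hc : hContOn d s T v) :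
    ContinuousOn (fun t => hnorm d s (v t)) (Set.Icc 0 T) := by
  intro t₀ ht₀
  refine tendsto_iff_dist_tendsto_zero.2 ?_
  refine squeeze_zero' (Filter.Eventually.of_forall fun _ => dist_nonneg) ?_ (hc t₀ ht₀)
  filter_upwards [self_mem_nhdsWithin] with t ht
  have h1 := isBd_sub_of_memH (hv t ht) (hv t₀ ht₀)
  have h2 := hnorm_le_of_isBd_sub (hnorm_nonneg d s _) (hv t ht) h1
  have h3 := hnorm_le_of_isBd_sub (hnorm_nonneg d s _) (hv t₀ ht₀)
    (h1.mono (y := fun k => ‖v t₀ k - v t k‖) (fun k => norm_nonneg _)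
      (fun k => (norm_sub_rev _ _).le) (hnorm_nonneg d s _) le_rfl)
  rw [Real.dist_eq, abs_le]
  constructor <;> linarith

lemma isBd_sub_trunc_mono {d : ℕ} {s : ℝ} {v : (Fin d → ℤ) → ℂ} {K K' : Finset (Fin d → ℤ)}
    (hK : K ⊆ K') {δ : ℝ} (hδ : 0 ≤ δ) (h : IsBd d s (fun k => ‖v k - trunc K v k‖) δ) :
    IsBd d s (fun k => ‖v k - trunc K' v k‖) δ := by
  refine h.mono (fun k => norm_nonneg _) (fun k => ?_) hδ le_rfl
  by_cases hk : k ∈ K'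
  · simp [trunc, hk]
  · have hk' : k ∉ K := fun h => hk (hK h)
    simp [trunc, hk, hk']

lemma exists_isBd_sub_trunc {d : ℕ} {s : ℝ} {v : (Fin d → ℤ) → ℂ} (hv : memH d s v) {δ : ℝ}
    (hδ : 0 < δ) : ∃ K, IsBd d s (fun k => ‖v k - trunc K v k‖) δ := by
  have hv' : Summable fun k => wt d s k * ‖v k‖ ^ 2 := hv
  obtain ⟨K, hK⟩ := summable_iff_vanishing_norm.1 hv' (δ ^ 2) (by positivity)
  refine ⟨K, fun J => ?_⟩
  have h := hK (J \ K) Finset.sdiff_disjoint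
  have e : ∑ k ∈ J, wt d s k * ‖v k - trunc K v k‖ ^ 2 =
      ∑ k ∈ J \ K, wt d s k * ‖v k‖ ^ 2 := by
    rw [← Finset.filter_notMem_eq_sdiff, Finset.sum_filter]
    refine Finset.sum_congr rfl fun k _ => ?_
    by_cases hk : k ∈ K <;> simp [trunc, hk]
  rw [e]
  exact (le_abs_self _).trans h.le

lemma hContOn.exists_isBd_sub_trunc {d : ℕ} {s T : ℝ} {v : ℝ → (Fin d → ℤ) → ℂ}
    (hv : ∀ t ∈ Set.Icc 0 T, memH d s (v t)) (hc : hContOn d s T v) {δ : ℝ} (hδ : 0 < δ) :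
    ∃ K, ∀ t ∈ Set.Icc 0 T, IsBd d s (fun k => ‖v t k - trunc K (v t) k‖) δ := by
  classical
  suffices h : ∃ K, ∀ t ∈ Set.Icc 0 T, t ∈ Set.Icc 0 T →
      IsBd d s (fun k => ‖v t k - trunc K (v t) k‖) δ by
    obtain ⟨K, hK⟩ := h
    exact ⟨K, fun t ht => hK t ht ht⟩
  refine isCompact_Icc.induction_on (p := fun S => ∃ K, ∀ t ∈ S, t ∈ Set.Icc 0 T →
    IsBd d s (fun k => ‖v t k - trunc K (v t) k‖) δ) ⟨∅, by simp⟩ ?_ ?_ ?_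
  · rintro S S' hS ⟨K, hK⟩
    exact ⟨K, fun t ht => hK t (hS ht)⟩
  · rintro S S' ⟨K, hK⟩ ⟨K', hK'⟩
    refine ⟨K ∪ K', fun t ht htT => ?_⟩
    rcases ht with ht | ht
    · exact isBd_sub_trunc_mono Finset.subset_union_left hδ.le (hK t ht htT)
    · exact isBd_sub_trunc_mono Finset.subset_union_right hδ.le (hK' t ht htT)
  · intro t₀ ht₀
    obtain ⟨K, hK⟩ := _root_.exists_isBd_sub_trunc (hv t₀ ht₀) (half_pos hδ)
    refine ⟨_, (hc t₀ ht₀).eventually (eventually_le_nhds (half_pos hδ)), K, fun t ht htT => ?_⟩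
    have h1 := isBd_sub_of_memH (hv t htT) (hv t₀ ht₀)
    refine (h1.add hK (hnorm_nonneg d s _) (half_pos hδ).le).mono (fun k => norm_nonneg _)
      (fun k => ?_) (add_nonneg (hnorm_nonneg d s _) (half_pos hδ).le) ?_
    · by_cases hk : k ∈ K
      · simp [trunc, hk]
      · simp only [trunc, hk, if_false, sub_zero]
        have : v t k = (v t k - v t₀ k) + v t₀ k := by ring
        nth_rw 1 [this]
        exact norm_add_le _ _
    · have : hnorm d s (fun k => v t k - v t₀ k) ≤ δ / 2 := ht
      linarith

lemma le_of_continuousOn_of_bootstrap {f : ℝ → ℝ} {T B : ℝ} (hf : ContinuousOn f (Set.Icc 0 T))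
    (h0 : f 0 < B)
    (h : ∀ t₀ ∈ Set.Icc 0 T, (∀ t ∈ Set.Icc 0 t₀, f t ≤ B) → f t₀ < B) :
    ∀ t ∈ Set.Icc 0 T, f t ≤ B := by
  by_contra! hcon
  obtain ⟨t₁, ht₁, hB⟩ := hcon
  have hcomp : IsCompact (Set.Icc 0 T ∩ f ⁻¹' Set.Ici B) :=
    isCompact_Icc.of_isClosed_subset (hf.preimage_isClosed_of_isClosed isClosed_Icc isClosed_Ici)
      Set.inter_subset_left
  obtain ⟨t₀, ⟨ht₀, hft₀⟩, hmin⟩ := hcomp.exists_isLeast ⟨t₁, ht₁, hB.le⟩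
  have hft₀ : B ≤ f t₀ := hft₀
  have hlt : ∀ t ∈ Set.Icc 0 T, t < t₀ → f t < B := fun t ht htt => by
    by_contra! hge
    exact absurd (hmin ⟨ht, hge⟩) (not_le.2 htt)
  obtain ⟨r, hr, hfr⟩ := intermediate_value_Icc ht₀.1 (hf.mono (Set.Icc_subset_Icc_right ht₀.2))
    ⟨h0.le, hft₀⟩
  have hrt : r = t₀ := le_antisymm hr.2 (hmin ⟨⟨hr.1, hr.2.trans ht₀.2⟩, hfr.ge⟩)
  refine absurd (h t₀ ht₀ fun t ht => ?_) (not_lt.2 hft₀)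
  rcases ht.2.eq_or_lt with e | hl
  · rw [e, ← hrt, hfr]
  · exact (hlt t ⟨ht.1, ht.2.trans ht₀.2⟩ hl).le

lemma tsum_wt_abs_sq_sub_le {d : ℕ} {σ A D : ℝ} {u w : (Fin d → ℤ) → ℂ} (hA : 0 ≤ A) (hD : 0 ≤ D)
    (hu : IsBd d σ (fun k => ‖u k‖) A) (hw : IsBd d σ (fun k => ‖w k‖) A)
    (huw : IsBd d σ (fun k => ‖u k - w k‖) D) :
    ∑' k, wt d σ k * |‖u k‖ ^ 2 - ‖w k‖ ^ 2| ≤ D * (A + A) := by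
  refine Real.tsum_le_of_sum_le (fun k => mul_nonneg (wt_pos d σ k).le (abs_nonneg _)) fun K => ?_
  refine le_trans (Finset.sum_le_sum fun k _ => ?_) (sum_weight_mul_le K (wt d σ)
    (fun k => ‖u k - w k‖) (fun k => ‖u k‖ + ‖w k‖) (fun k => (wt_pos d σ k).le) hD
    (by positivity) (huw K) (hu.add hw hA hA K))
  refine mul_le_mul_of_nonneg_left ?_ (wt_pos d σ k).le
  rw [sq_sub_sq, abs_mul, mul_comm, abs_of_nonneg (add_nonneg (norm_nonneg _) (norm_nonneg _))]
  exact mul_le_mul_of_nonneg_right (abs_norm_sub_norm_le _ _) (by positivity)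

/-- main averaging theorem: let `d, m, p, q ≥ 1`, `μ ≥ 0`, `b, c ∈ ℝ`,
`s > d/2`, `s₁ ∈ (d/2, s)` with `s − s₁ ≤ m`, `T > 0`, `M > 0`.  There exist `ε₀ > 0`
and `C > 0` (depending only on these data) such that for every `ε ∈ (0, ε₀)`, every
`h^s`-continuous solution `v` of the rescaled CGL system
`v̇_k = ε⁻¹iλ_k v_k − μλ_k^m v_k + bP_k(v,p) + icP_k(v,q)` on `[0,T]` with
`|v(τ)|_s ≤ M`, and every `h^s`-continuous solution `a′` of the effective equation
`ȧ′_k = −μλ_k^m a′_k + bR_k(a′,p) + icR_k(a′,q)` on `[0,T]` with `a′(0) = v(0)`,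
one has `|a′(τ)|_s ≤ M + 1` and
`Σ_k (|k|^{2s₁}+1)||v_k(τ)|² − |a′_k(τ)|²| ≤ C(ε^{(s−s₁)/(2m)} + ε^{1/2})` on `[0,T]`. -/
theorem averaging_main (d m p q : ℕ) (hd : 1 ≤ d) (hm : 1 ≤ m) (hp : 1 ≤ p)
    (hq : 1 ≤ q) (μ b c : ℝ) (hμ : 0 ≤ μ) (s s₁ T M : ℝ)
    (hs : (d : ℝ) / 2 < s) (hs₁l : (d : ℝ) / 2 < s₁) (hs₁u : s₁ < s)
    (hsm : s - s₁ ≤ (m : ℝ)) (hT : 0 < T) (hM : 0 < M) :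
    ∃ ε₀ : ℝ, 0 < ε₀ ∧ ∃ C : ℝ, 0 < C ∧
      ∀ ε : ℝ, 0 < ε → ε < ε₀ →
      ∀ v a' : ℝ → (Fin d → ℤ) → ℂ,
        (∀ τ ∈ Set.Icc (0 : ℝ) T, memH d s (v τ) ∧ hnorm d s (v τ) ≤ M) →
        hContOn d s T v →
        (∀ τ ∈ Set.Icc (0 : ℝ) T, ∀ k : Fin d → ℤ,
          HasDerivWithinAt (fun t => v t k)
            (((ε : ℂ))⁻¹ * Complex.I * (lam d k : ℂ) * v τ k
              - (μ : ℂ) * (lam d k : ℂ) ^ m * v τ k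
              + (b : ℂ) * Pk d p (v τ) k + Complex.I * (c : ℂ) * Pk d q (v τ) k)
            (Set.Icc 0 T) τ) →
        (∀ τ ∈ Set.Icc (0 : ℝ) T, memH d s (a' τ)) →
        hContOn d s T a' →
        a' 0 = v 0 →
        (∀ τ ∈ Set.Icc (0 : ℝ) T, ∀ k : Fin d → ℤ,
          HasDerivWithinAt (fun t => a' t k)
            (-(μ : ℂ) * (lam d k : ℂ) ^ m * a' τ k
              + (b : ℂ) * Rk d p (a' τ) k + Complex.I * (c : ℂ) * Rk d q (a' τ) k)
            (Set.Icc 0 T) τ) →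
        (∀ τ ∈ Set.Icc (0 : ℝ) T, hnorm d s (a' τ) ≤ M + 1) ∧
        (∀ τ ∈ Set.Icc (0 : ℝ) T,
          ∑' k, wt d s₁ k * |‖v τ k‖ ^ 2 - ‖a' τ k‖ ^ 2|
            ≤ C * (ε ^ ((s - s₁) / (2 * (m : ℝ))) + ε ^ ((1 : ℝ) / 2))) := by
  have hA : 1 ≤ M + 1 := by linarith
  have hA0 : 0 ≤ M + 1 := by linarith
  obtain ⟨C, hC0, hC⟩ := exists_isBd_sub_rpow (p := p) (q := q) (T := T) hd hm b c hμ hs₁l hs₁u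
    hsm hA
  have hclose : ∃ ε₀ : ℝ, 0 < ε₀ ∧ ∀ ε t₀ : ℝ, 0 < ε → ε < ε₀ → t₀ ≤ T →
      ∀ u u' : ℝ → (Fin d → ℤ) → ℂ,
      (∀ δ > 0, ∃ K, ∀ t ∈ Set.Icc 0 t₀, IsBd d s (fun k => ‖u t k - trunc K (u t) k‖) δ ∧
        IsBd d s (fun k => ‖u' t k - trunc K (u' t) k‖) δ) →
      (∀ t ∈ Set.Icc 0 t₀, IsBd d s (fun k => ‖u t k‖) (M + 1)) →
      (∀ t ∈ Set.Icc 0 t₀, IsBd d s (fun k => ‖u' t k‖) (M + 1)) →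
      SolvesDamped d m p q μ b c t₀ (fun t => oscMul d p (t / ε)) (fun t => oscMul d q (t / ε)) u →
      SolvesDamped d m p q μ b c t₀ (fun _ => resMul d p) (fun _ => resMul d q) u' →
      u' 0 = u 0 →
      ∀ t ∈ Set.Icc 0 t₀, IsBd d s (fun k => ‖u t k - u' t k‖) (3 / 4) := by
    rcases hμ.eq_or_lt with rfl | hμ
    · exact exists_isBd_sub_of_zero hd b c hs hA0
    · obtain ⟨ε₀, hε₀, h⟩ := exists_isBd_sub_of_pos (p := p) (q := q) (T := T) hd hm b c hμ hs₁l
        hs₁u hsm hA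
      exact ⟨ε₀, hε₀, fun ε t₀ h1 h2 h3 u u' _ => h ε t₀ h1 h2 h3 u u'⟩
  obtain ⟨ε₀, hε₀, hclose⟩ := hclose
  refine ⟨min ε₀ 1, lt_min hε₀ one_pos, C * (M + 1 + (M + 1)), by positivity, ?_⟩
  intro ε hε hεε v a' hv hvc hdv ha' hac h0 hda
  set u : ℝ → (Fin d → ℤ) → ℂ := fun t => interact d (t / ε) (v t) with hu
  have hun : ∀ t k, ‖u t k‖ = ‖v t k‖ := fun t k => norm_interact d _ _ _
  have huA : ∀ t ∈ Set.Icc 0 T, IsBd d s (fun k => ‖u t k‖) (M + 1) := fun t ht => by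
    simp only [hun]
    exact (hv t ht).1.isBd.mono (fun k => norm_nonneg _) (fun k => le_rfl) (hnorm_nonneg d s _)
      ((hv t ht).2.trans (by linarith))
  have hdu : SolvesDamped d m p q μ b c T (fun t => oscMul d p (t / ε))
      (fun t => oscMul d q (t / ε)) u := fun t ht k => hasDerivWithinAt_interact (hdv t ht k)
  have hda' : SolvesDamped d m p q μ b c T (fun _ => resMul d p) (fun _ => resMul d q) a' :=
    fun t ht k => (hda t ht k).congr_deriv (by
      rw [nlin, Rk_eq_msum, Rk_eq_msum]; push_cast; ring)
  have h0' : a' 0 = u 0 := by simp [hu, h0]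
  have htail : ∀ δ > 0, ∃ K, ∀ t ∈ Set.Icc 0 T,
      IsBd d s (fun k => ‖u t k - trunc K (u t) k‖) δ ∧
        IsBd d s (fun k => ‖a' t k - trunc K (a' t) k‖) δ := by
    classical
    intro δ hδ
    obtain ⟨K, hK⟩ := hvc.exists_isBd_sub_trunc (fun t ht => (hv t ht).1) hδ
    obtain ⟨K', hK'⟩ := hac.exists_isBd_sub_trunc ha' hδ
    refine ⟨K ∪ K', fun t ht => ⟨isBd_sub_trunc_mono Finset.subset_union_left hδ.le ?_,
      isBd_sub_trunc_mono Finset.subset_union_right hδ.le (hK' t ht)⟩⟩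
    refine (hK t ht).mono (fun k => norm_nonneg _) (fun k => ?_) hδ.le le_rfl
    by_cases hk : k ∈ K <;> simp [trunc, hk, hun]
  have hbound : ∀ τ ∈ Set.Icc (0 : ℝ) T, hnorm d s (a' τ) ≤ M + 1 := by
    refine le_of_continuousOn_of_bootstrap (hac.continuousOn_hnorm ha') ?_ fun t₀ ht₀ hle => ?_
    · rw [h0]
      linarith [(hv 0 ⟨le_rfl, hT.le⟩).2]
    · have hsub : Set.Icc 0 t₀ ⊆ Set.Icc 0 T := Set.Icc_subset_Icc_right ht₀.2
      have h1 := hclose ε t₀ hε (hεε.trans_le (min_le_left _ _)) ht₀.2 u a'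
        (fun δ hδ => (htail δ hδ).imp fun K hK t ht => hK t (hsub ht))
        (fun t ht => huA t (hsub ht))
        (fun t ht => (ha' t (hsub ht)).isBd.mono (fun k => norm_nonneg _) (fun k => le_rfl)
          (hnorm_nonneg d s _) (hle t ht))
        (hdu.mono ht₀.2) (hda'.mono ht₀.2) h0' t₀ ⟨ht₀.1, le_rfl⟩
      have h2 : hnorm d s (u t₀) = hnorm d s (v t₀) := by simp only [hnorm, hun]
      have h3 := hnorm_le_of_isBd_sub (by norm_num) (huA t₀ ht₀).summable h1
      have h4 := (hv t₀ ht₀).2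
      linarith
  refine ⟨hbound, fun τ hτ => ?_⟩
  have haA : ∀ t ∈ Set.Icc 0 T, IsBd d s (fun k => ‖a' t k‖) (M + 1) := fun t ht =>
    (ha' t ht).isBd.mono (fun k => norm_nonneg _) (fun k => le_rfl) (hnorm_nonneg d s _)
      (hbound t ht)
  have hσ0 : 0 < s₁ := lt_of_le_of_lt (by positivity) hs₁l
  have hε1 : ε ≤ 1 := hεε.le.trans (min_le_right _ _)
  have h1 := tsum_wt_abs_sq_sub_le hA0 (by positivity)
    ((huA τ hτ).mono_exponent hσ0 hs₁u.le) ((haA τ hτ).mono_exponent hσ0 hs₁u.le)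
    (hC ε T hε hε1 le_rfl u a' huA haA hdu hda' h0' τ hτ)
  simp only [hun] at h1
  refine h1.trans ?_
  have h2 : 0 ≤ C * (M + 1 + (M + 1)) * ε ^ ((1 : ℝ) / 2) := by positivity
  linarith
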